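/- arXiv:1706.04281 — 5 statements merged into one kernel-verified Lean document; each statement's English description precedes it below -/
import Mathlib

section
/- Suppose u, û, z : [0,T] → H are continuously differentiable, f : [0,T] → H is continuous, u solves the primal problem (u'(t), v) + B(u(t), v) + N(u(t); v) = (f(t), v) for all v ∈ H and all t ∈ [0,T], and z solves the mean-value-linearized backward-in-time dual problem −(z'(t), w) + B(z(t), w) + N^s(u(t), û(t); w, z(t)) = (q(t), w) for all w ∈ H and all t ∈ [0,T], with terminal condition z(T) = q̄. Then the global space-time error representation holds: Q(u) − Q(û) = (u(0) − û(0), z(0)) + ∫₀ᵀ R_PDE(û(t); z(t)) dt, where the PDE residual is R_PDE(û(t); v) := (f(t), v) − (û'(t), v) − B(û(t), v) − N(û(t); v). -/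
open MeasureTheory RealInnerProductSpace

/-- Global space-time error representation: if `u` solves the primal semi-linear parabolic
problem and `z` solves the mean-value-linearized backward-in-time dual problem with terminal
condition `z(T) = q̄`, then for any (continuously differentiable) approximation `û`,
`Q(u) - Q(û) = (u(0) - û(0), z(0)) + ∫₀ᵀ R_PDE(û(t); z(t)) dt`. -/
theorem global_space_time_error_representation
    {H : Type*} [NormedAddCommGroup H] [InnerProductSpace ℝ H] [CompleteSpace H]
    (B Nc Ne : H → H → ℝ) (Ncs Nes : H → H → H → H → ℝ)
    (hB_cont : Continuous fun p : H × H => B p.1 p.2)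
    (hB_symm : ∀ a b : H, B a b = B b a)
    (hB_add : ∀ a b v : H, B (a + b) v = B a v + B b v)
    (hB_smul : ∀ (c : ℝ) (a v : H), B (c • a) v = c * B a v)
    (hNc_cont : Continuous fun p : H × H => Nc p.1 p.2)
    (hNe_cont : Continuous fun p : H × H => Ne p.1 p.2)
    (hNc_add : ∀ u v w : H, Nc u (v + w) = Nc u v + Nc u w)
    (hNc_smul : ∀ (u : H) (c : ℝ) (v : H), Nc u (c • v) = c * Nc u v)
    (hNe_add : ∀ u v w : H, Ne u (v + w) = Ne u v + Ne u w)
    (hNe_smul : ∀ (u : H) (c : ℝ) (v : H), Ne u (c • v) = c * Ne u v)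
    (hNcs_cont : Continuous fun p : (H × H) × H × H => Ncs p.1.1 p.1.2 p.2.1 p.2.2)
    (hNes_cont : Continuous fun p : (H × H) × H × H => Nes p.1.1 p.1.2 p.2.1 p.2.2)
    (hNcs_addw : ∀ a b w₁ w₂ v : H, Ncs a b (w₁ + w₂) v = Ncs a b w₁ v + Ncs a b w₂ v)
    (hNcs_smulw : ∀ (a b : H) (c : ℝ) (w v : H), Ncs a b (c • w) v = c * Ncs a b w v)
    (hNcs_addv : ∀ a b w v₁ v₂ : H, Ncs a b w (v₁ + v₂) = Ncs a b w v₁ + Ncs a b w v₂)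
    (hNcs_smulv : ∀ (a b : H) (c : ℝ) (w v : H), Ncs a b w (c • v) = c * Ncs a b w v)
    (hNes_addw : ∀ a b w₁ w₂ v : H, Nes a b (w₁ + w₂) v = Nes a b w₁ v + Nes a b w₂ v)
    (hNes_smulw : ∀ (a b : H) (c : ℝ) (w v : H), Nes a b (c • w) v = c * Nes a b w v)
    (hNes_addv : ∀ a b w v₁ v₂ : H, Nes a b w (v₁ + v₂) = Nes a b w v₁ + Nes a b w v₂)
    (hNes_smulv : ∀ (a b : H) (c : ℝ) (w v : H), Nes a b w (c • v) = c * Nes a b w v)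
    (hNcs_mvl : ∀ a b v : H, Ncs a b (a - b) v = Nc a v - Nc b v)
    (hNes_mvl : ∀ a b v : H, Nes a b (a - b) v = Ne a v - Ne b v)
    (T : ℝ) (hT : 0 < T)
    (qbar : H) (q : ℝ → H) (hq : ContinuousOn q (Set.Icc 0 T))
    (f : ℝ → H) (hf : ContinuousOn f (Set.Icc 0 T))
    (u uhat z u' uhat' z' : ℝ → H)
    (hu : ∀ s ∈ Set.Icc (0:ℝ) T, HasDerivAt u (u' s) s)
    (hu' : ContinuousOn u' (Set.Icc 0 T))
    (huhat : ∀ s ∈ Set.Icc (0:ℝ) T, HasDerivAt uhat (uhat' s) s)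
    (huhat' : ContinuousOn uhat' (Set.Icc 0 T))
    (hz : ∀ s ∈ Set.Icc (0:ℝ) T, HasDerivAt z (z' s) s)
    (hz' : ContinuousOn z' (Set.Icc 0 T))
    (hprimal : ∀ s ∈ Set.Icc (0:ℝ) T, ∀ v : H,
      ⟪u' s, v⟫ + B (u s) v + (Nc (u s) v - Ne (u s) v) = ⟪f s, v⟫)
    (hdual : ∀ s ∈ Set.Icc (0:ℝ) T, ∀ w : H,
      -⟪z' s, w⟫ + B (z s) w
          + (Ncs (u s) (uhat s) w (z s) - Nes (u s) (uhat s) w (z s)) = ⟪q s, w⟫)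
    (hzT : z T = qbar) :
    (⟪qbar, u T⟫ + ∫ s in (0:ℝ)..T, ⟪q s, u s⟫)
        - (⟪qbar, uhat T⟫ + ∫ s in (0:ℝ)..T, ⟪q s, uhat s⟫)
      = ⟪u 0 - uhat 0, z 0⟫
        + ∫ s in (0:ℝ)..T,
            (⟪f s, z s⟫ - ⟪uhat' s, z s⟫ - B (uhat s) (z s)
              - (Nc (uhat s) (z s) - Ne (uhat s) (z s))) := by
  have hIcc : Set.uIcc 0 T = Set.Icc 0 T := Set.uIcc_of_le hT.le
  have hu_cont : ContinuousOn u (Set.uIcc 0 T) := fun s hs =>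
    (hu s (hIcc ▸ hs)).continuousAt.continuousWithinAt
  have huhat_cont : ContinuousOn uhat (Set.uIcc 0 T) := fun s hs =>
    (huhat s (hIcc ▸ hs)).continuousAt.continuousWithinAt
  have hz_cont : ContinuousOn z (Set.uIcc 0 T) := fun s hs =>
    (hz s (hIcc ▸ hs)).continuousAt.continuousWithinAt
  rw [← hIcc] at hq hu' huhat' hz'
  have hqu : IntervalIntegrable (fun s => ⟪q s, u s⟫) volume 0 T :=
    (hq.inner hu_cont).intervalIntegrable
  have hquhat : IntervalIntegrable (fun s => ⟪q s, uhat s⟫) volume 0 T :=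
    (hq.inner huhat_cont).intervalIntegrable
  have hpair : IntervalIntegrable
      (fun s => ⟪u s - uhat s, z' s⟫ + ⟪u' s - uhat' s, z s⟫) volume 0 T :=
    (((hu_cont.sub huhat_cont).inner hz').add
      ((hu'.sub huhat').inner hz_cont)).intervalIntegrable
  have hparts : ∫ s in (0:ℝ)..T, (⟪u s - uhat s, z' s⟫ + ⟪u' s - uhat' s, z s⟫)
      = ⟪u T - uhat T, z T⟫ - ⟪u 0 - uhat 0, z 0⟫ := by
    refine intervalIntegral.integral_eq_sub_of_hasDerivAt
      (f := fun s => ⟪u s - uhat s, z s⟫) (fun s hs => ?_) hpair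
    rw [hIcc] at hs
    exact ((hu s hs).sub (huhat s hs)).inner ℝ (hz s hs)
  have hresidual : ∀ s ∈ Set.uIcc 0 T,
      ⟪f s, z s⟫ - ⟪uhat' s, z s⟫ - B (uhat s) (z s) - (Nc (uhat s) (z s) - Ne (uhat s) (z s))
        = (⟪q s, u s⟫ - ⟪q s, uhat s⟫)
          + (⟪u s - uhat s, z' s⟫ + ⟪u' s - uhat' s, z s⟫) := by
    intro s hs
    rw [hIcc] at hs
    have hp := hprimal s hs (z s)
    have hd := hdual s hs (u s - uhat s)
    have hB := hB_add (u s - uhat s) (uhat s) (z s)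
    rw [sub_add_cancel] at hB
    rw [hNcs_mvl, hNes_mvl, hB_symm, inner_sub_right (q s), real_inner_comm] at hd
    rw [inner_sub_left (u' s)]
    linarith
  rw [intervalIntegral.integral_congr hresidual,
    intervalIntegral.integral_add (hqu.sub hquhat) hpair,
    intervalIntegral.integral_sub hqu hquhat, hparts, hzT, inner_sub_left (u T),
    real_inner_comm (u T), real_inner_comm (uhat T)]
  ring
end

section
/- Let u₀, …, u_N be the time-discrete IMEX primal solution, let u₀^h, …, u_N^h be the fully discrete IMEX–Galerkin solution, and let z₀, …, z_N be the IMEX time-discrete dual solution for data q₀, …, q_N ∈ H and q̄ ∈ H. Then for any choice of v_k^h ∈ S_k (k = 0, …, N), the time-discrete error representation holds: τ₁ (q₀, u₀ − u₀^h) + Σ_{k=1}^N τ_k (q_k, u_k − u_k^h) + (q̄, u_N − u_N^h) = (u⁰ − u₀^h, z₀ − v₀^h) + Σ_{k=1}^N τ_k ⟨r_h^k, z_k − v_k^h⟩. -/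
open MeasureTheory RealInnerProductSpace

/-- Time-discrete error representation: with `u_τ` the time-discrete IMEX primal solution,
`u_τh` the fully discrete IMEX–Galerkin solution and `z_τ` the specially-tailored IMEX
time-discrete dual solution, for any `v_k^h ∈ S_k`,
`τ₁(q₀, u₀ - u₀ʰ) + Σ_{k=1}^N τ_k (q_k, u_k - u_kʰ) + (q̄, u_N - u_Nʰ)
  = (u⁰ - u₀ʰ, z₀ - v₀ʰ) + Σ_{k=1}^N τ_k ⟨r_h^k, z_k - v_kʰ⟩`. -/
theorem time_discrete_error_representation
    {H : Type*} [NormedAddCommGroup H] [InnerProductSpace ℝ H] [CompleteSpace H]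
    (B Nc Ne : H → H → ℝ) (Ncs Nes : H → H → H → H → ℝ)
    (hB_cont : Continuous fun p : H × H => B p.1 p.2)
    (hB_symm : ∀ a b : H, B a b = B b a)
    (hB_add : ∀ a b v : H, B (a + b) v = B a v + B b v)
    (hB_smul : ∀ (c : ℝ) (a v : H), B (c • a) v = c * B a v)
    (hNc_cont : Continuous fun p : H × H => Nc p.1 p.2)
    (hNe_cont : Continuous fun p : H × H => Ne p.1 p.2)
    (hNc_add : ∀ u v w : H, Nc u (v + w) = Nc u v + Nc u w)
    (hNc_smul : ∀ (u : H) (c : ℝ) (v : H), Nc u (c • v) = c * Nc u v)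
    (hNe_add : ∀ u v w : H, Ne u (v + w) = Ne u v + Ne u w)
    (hNe_smul : ∀ (u : H) (c : ℝ) (v : H), Ne u (c • v) = c * Ne u v)
    (hNcs_addw : ∀ a b w₁ w₂ v : H, Ncs a b (w₁ + w₂) v = Ncs a b w₁ v + Ncs a b w₂ v)
    (hNcs_smulw : ∀ (a b : H) (c : ℝ) (w v : H), Ncs a b (c • w) v = c * Ncs a b w v)
    (hNcs_addv : ∀ a b w v₁ v₂ : H, Ncs a b w (v₁ + v₂) = Ncs a b w v₁ + Ncs a b w v₂)
    (hNcs_smulv : ∀ (a b : H) (c : ℝ) (w v : H), Ncs a b w (c • v) = c * Ncs a b w v)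
    (hNes_addw : ∀ a b w₁ w₂ v : H, Nes a b (w₁ + w₂) v = Nes a b w₁ v + Nes a b w₂ v)
    (hNes_smulw : ∀ (a b : H) (c : ℝ) (w v : H), Nes a b (c • w) v = c * Nes a b w v)
    (hNes_addv : ∀ a b w v₁ v₂ : H, Nes a b w (v₁ + v₂) = Nes a b w v₁ + Nes a b w v₂)
    (hNes_smulv : ∀ (a b : H) (c : ℝ) (w v : H), Nes a b w (c • v) = c * Nes a b w v)
    (hNcs_mvl : ∀ a b v : H, Ncs a b (a - b) v = Nc a v - Nc b v)
    (hNes_mvl : ∀ a b v : H, Nes a b (a - b) v = Ne a v - Ne b v)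
    (T : ℝ) (hT : 0 < T)
    (N : ℕ) (hN : 1 ≤ N)
    (t : ℕ → ℝ) (ht0 : t 0 = 0) (htT : t N = T)
    (ht : ∀ k < N, t k < t (k + 1))
    (S : ℕ → Submodule ℝ H) (hS : ∀ k ≤ N, IsClosed (S k : Set H))
    (u0 : H) (fd : ℕ → H)
    (ud : ℕ → H)
    (hud0 : ∀ v : H, ⟪ud 0, v⟫ = ⟪u0, v⟫)
    (hud : ∀ k < N, ∀ v : H,
      ⟪(t (k + 1) - t k)⁻¹ • (ud (k + 1) - ud k), v⟫ + B (ud (k + 1)) v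
        + Nc (ud (k + 1)) v - Ne (ud k) v = ⟪fd (k + 1), v⟫)
    (uh : ℕ → H) (huh_mem : ∀ k ≤ N, uh k ∈ S k)
    (huh0 : ∀ v ∈ S 0, ⟪uh 0, v⟫ = ⟪u0, v⟫)
    (huh : ∀ k < N, ∀ v ∈ S (k + 1),
      ⟪(t (k + 1) - t k)⁻¹ • (uh (k + 1) - uh k), v⟫ + B (uh (k + 1)) v
        + Nc (uh (k + 1)) v - Ne (uh k) v = ⟪fd (k + 1), v⟫)
    (qbar : H) (qd : ℕ → H)
    (zd : ℕ → H)
    (hzd0 : ∀ w : H,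
      -⟪(t 1 - t 0)⁻¹ • (zd 1 - zd 0), w⟫ - Nes (ud 0) (uh 0) w (zd 1) = ⟪qd 0, w⟫)
    (hzdk : ∀ k, 1 ≤ k → k < N → ∀ w : H,
      -⟪(t k - t (k - 1))⁻¹ • (zd (k + 1) - zd k), w⟫ + B (zd k) w
          + Ncs (ud k) (uh k) w (zd k)
          - ((t (k + 1) - t k) / (t k - t (k - 1))) * Nes (ud k) (uh k) w (zd (k + 1))
        = ⟪qd k, w⟫)
    (hzdN : ∀ w : H,
      ⟪zd N, w⟫ + (t N - t (N - 1)) * B (zd N) w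
          + (t N - t (N - 1)) * Ncs (ud N) (uh N) w (zd N)
        = (t N - t (N - 1)) * ⟪qd N, w⟫ + ⟪qbar, w⟫) :
    ∀ vh : ℕ → H, (∀ k ≤ N, vh k ∈ S k) →
      (t 1 - t 0) * ⟪qd 0, ud 0 - uh 0⟫
          + (∑ k ∈ Finset.Icc 1 N, (t k - t (k - 1)) * ⟪qd k, ud k - uh k⟫)
          + ⟪qbar, ud N - uh N⟫
        = ⟪u0 - uh 0, zd 0 - vh 0⟫
          + ∑ k ∈ Finset.Icc 1 N,
              (t k - t (k - 1)) *
                (⟪fd k, zd k - vh k⟫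
                  - ⟪(t k - t (k - 1))⁻¹ • (uh k - uh (k - 1)), zd k - vh k⟫
                  - B (uh k) (zd k - vh k) - Nc (uh k) (zd k - vh k)
                  + Ne (uh (k - 1)) (zd k - vh k)) := by
  intro vh hvh
  have sub_right : ∀ F : H → H → ℝ, (∀ u v w, F u (v + w) = F u v + F u w) →
      ∀ u v w, F u (v - w) = F u v - F u w := by
    intro F hF u v w
    have h := hF u (v - w) w
    rw [sub_add_cancel] at h
    linarith
  have hB_sub_left : ∀ a b v, B (a - b) v = B a v - B b v := by
    intro a b v
    have h := hB_add (a - b) b v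
    rw [sub_add_cancel] at h
    linarith
  have hB_sub_right : ∀ v a b, B v (a - b) = B v a - B v b := by
    intro v a b
    rw [hB_symm, hB_sub_left, hB_symm a, hB_symm b]
  have residual_eq : ∀ k < N, (t (k + 1) - t k) *
      (⟪fd (k + 1), zd (k + 1) - vh (k + 1)⟫
        - ⟪(t (k + 1) - t k)⁻¹ • (uh (k + 1) - uh k), zd (k + 1) - vh (k + 1)⟫
        - B (uh (k + 1)) (zd (k + 1) - vh (k + 1)) - Nc (uh (k + 1)) (zd (k + 1) - vh (k + 1))
        + Ne (uh k) (zd (k + 1) - vh (k + 1)))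
      = ⟪ud (k + 1) - uh (k + 1), zd (k + 1)⟫ - ⟪ud k - uh k, zd (k + 1)⟫
        + (t (k + 1) - t k) * (B (zd (k + 1)) (ud (k + 1) - uh (k + 1))
          + Ncs (ud (k + 1)) (uh (k + 1)) (ud (k + 1) - uh (k + 1)) (zd (k + 1))
          - Nes (ud k) (uh k) (ud k - uh k) (zd (k + 1))) := by
    intro k hk
    have hτ : t (k + 1) - t k ≠ 0 := (sub_pos.2 (ht k hk)).ne'
    have hz := hud k hk (zd (k + 1))
    have hv := huh k hk (vh (k + 1)) (hvh (k + 1) hk)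
    rw [hNcs_mvl, hNes_mvl, sub_right Nc hNc_add, sub_right Ne hNe_add, hB_sub_right,
      hB_sub_right, hB_symm (zd (k + 1)), hB_symm (zd (k + 1)), inner_sub_right,
      inner_sub_right, ← hz, ← hv]
    simp only [real_inner_smul_left, inner_sub_left]
    field_simp
    ring
  have partial_sum : ∀ M < N,
      (t 1 - t 0) * ⟪qd 0, ud 0 - uh 0⟫
          + (∑ k ∈ Finset.Icc 1 M, (t k - t (k - 1)) * ⟪qd k, ud k - uh k⟫)
          + ⟪ud M - uh M, zd (M + 1)⟫
          + (t (M + 1) - t M) * Nes (ud M) (uh M) (ud M - uh M) (zd (M + 1))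
        = ⟪u0 - uh 0, zd 0 - vh 0⟫
          + ∑ k ∈ Finset.Icc 1 M,
              (t k - t (k - 1)) *
                (⟪fd k, zd k - vh k⟫
                  - ⟪(t k - t (k - 1))⁻¹ • (uh k - uh (k - 1)), zd k - vh k⟫
                  - B (uh k) (zd k - vh k) - Nc (uh k) (zd k - vh k)
                  + Ne (uh (k - 1)) (zd k - vh k)) := by
    intro M
    induction M with
    | zero =>
      intro h0
      have hτ : t 1 - t 0 ≠ 0 := (sub_pos.2 (ht 0 h0)).ne'
      have hv := huh0 (vh 0) (hvh 0 (Nat.zero_le N))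
      have hz := hud0 (zd 0)
      simp only [Finset.Icc_eq_empty_of_lt Nat.zero_lt_one, Finset.sum_empty, zero_add]
      rw [← hzd0, real_inner_smul_left, real_inner_comm (zd 1), inner_sub_left (zd 1),
        inner_sub_right (u0 - uh 0), inner_sub_left u0, inner_sub_left u0, ← hz, ← hv,
        real_inner_comm (ud 0 - uh 0) (zd 0), inner_sub_left (ud 0) (uh 0) (zd 0)]
      field_simp
      ring
    | succ M ih =>
      intro hM
      have hprev := ih (by omega)
      have hτ : t (M + 1) - t M ≠ 0 := (sub_pos.2 (ht M (by omega))).ne'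
      have hres := residual_eq M (by omega)
      have hdual := congrArg (fun x => (t (M + 1) - t M) * x)
        (hzdk (M + 1) (by omega) hM (ud (M + 1) - uh (M + 1)))
      simp only [Nat.add_sub_cancel, real_inner_smul_left, inner_sub_left (zd (M + 1 + 1)),
        mul_sub, mul_add, mul_neg, ← mul_assoc, mul_inv_cancel₀ hτ, mul_div_cancel₀ _ hτ,
        one_mul] at hdual
      rw [real_inner_comm _ (zd (M + 1 + 1)), real_inner_comm _ (zd (M + 1))] at hdual
      rw [Finset.sum_Icc_succ_top (by omega), Finset.sum_Icc_succ_top (by omega)]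
      simp only [Nat.add_sub_cancel]
      rw [hres]
      linarith
  obtain ⟨M, rfl⟩ : ∃ M, N = M + 1 := ⟨N - 1, by omega⟩
  have hprev := partial_sum M (Nat.lt_succ_self M)
  have hres := residual_eq M (Nat.lt_succ_self M)
  have hdual := hzdN (ud (M + 1) - uh (M + 1))
  rw [real_inner_comm _ (zd (M + 1))] at hdual
  simp only [Nat.add_sub_cancel] at hdual
  rw [Finset.sum_Icc_succ_top (by omega), Finset.sum_Icc_succ_top (by omega)]
  simp only [Nat.add_sub_cancel]
  rw [hres]
  linarith
end

section
/- Assume: u : [0,T] → H is continuously differentiable with u(0) = u⁰ and solves the primal problem (u'(t), v) + B(u(t), v) + N(u(t); v) = (f(t), v) for all v ∈ H and t ∈ [0,T], where f : [0,T] → H is continuous and f_k := f(t_k); u₀, …, u_N is the time-discrete IMEX primal solution and u₀^h, …, u_N^h the fully discrete IMEX–Galerkin solution with data u⁰ and f₁, …, f_N; z : [0,T] → H is continuously differentiable, z(T) = q̄, and solves the dual problem −(z'(t), w) + B(z(t), w) + N^s(u(t), I u_τh(t); w, z(t)) = (q(t), w) for all w ∈ H and t ∈ [0,T], where I u_τh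 is the piecewise-linear time reconstruction of u₀^h, …, u_N^h; z₀, …, z_N is the IMEX time-discrete dual solution with data q̄ and q_k := (1/τ_k) ∫₀ᵀ N_k(t) q(t) dt (k = 1, …, N), q₀ := (1/τ₁) ∫₀ᵀ N₀(t) q(t) dt, where N_k are the hat functions. Then the decomposed error representation holds: for any v_k^h ∈ S_k (k = 0, …, N), Q(u) − Q(I u_τh) = R_s + R_t + Osc, where the spatial error representation is R_s := (u⁰ − u₀^h, z₀ − v₀^h) + Σ_{k=1}^N τ_k ⟨r_h^k, z_k − v_k^h⟩, the temporal error representation is R_t := (u⁰ − u₀^h, z(0) − z₀) + Σ_{k=0}^{N−1} ∫_{t_k}^{t_{k+1}} [ R_PDE(I u_τh(t); z(t) − z_{k+1}) + ⟨r_τ^{k+1}(t), z_{k+1}⟩ ] dt, and the data-oscillation contribution is Osc := Σ_{k=0}^{N−1} ∫_{t_k}^{t_{k+1}} (f(t) − f_{k+1}, z_{k+1}) dt. -/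
open MeasureTheory RealInnerProductSpace

/-- Error identity on one time step: the error functional over `[a, b]` equals the boundary terms
plus the contributions of the spatial residual, the temporal residual and the data oscillation,
for an arbitrary test vector `w`. -/
theorem error_identity_on_step
    {H : Type*} [NormedAddCommGroup H] [InnerProductSpace ℝ H]
    {B Nc Ne : H → H → ℝ} {Ncs Nes : H → H → H → H → ℝ}
    (hB_cont : Continuous fun p : H × H => B p.1 p.2)
    (hB_symm : ∀ a b : H, B a b = B b a)
    (hB_sub : ∀ x v w : H, B x (v - w) = B x v - B x w)
    (hNc_cont : Continuous fun p : H × H => Nc p.1 p.2)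
    (hNe_cont : Continuous fun p : H × H => Ne p.1 p.2)
    (hNc_sub : ∀ u v w : H, Nc u (v - w) = Nc u v - Nc u w)
    (hNe_sub : ∀ u v w : H, Ne u (v - w) = Ne u v - Ne u w)
    (hNcs_mvl : ∀ a b v : H, Ncs a b (a - b) v = Nc a v - Nc b v)
    (hNes_mvl : ∀ a b v : H, Nes a b (a - b) v = Ne a v - Ne b v)
    {a b : ℝ} (hab : a < b) {q f U u u' z z' : ℝ → H} {x y : H} (c w : H)
    (hq : ContinuousOn q (Set.Icc a b)) (hf : ContinuousOn f (Set.Icc a b))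
    (hU : ∀ s ∈ Set.Icc a b, U s = ((b - s) / (b - a)) • x + ((s - a) / (b - a)) • y)
    (hu : ∀ s ∈ Set.Icc a b, HasDerivAt u (u' s) s) (hu' : ContinuousOn u' (Set.Icc a b))
    (hz : ∀ s ∈ Set.Icc a b, HasDerivAt z (z' s) s) (hz' : ContinuousOn z' (Set.Icc a b))
    (hprimal : ∀ s ∈ Set.Icc a b, ∀ v : H,
      ⟪u' s, v⟫ + B (u s) v + (Nc (u s) v - Ne (u s) v) = ⟪f s, v⟫)
    (hdual : ∀ s ∈ Set.Icc a b, ∀ v : H,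
      -⟪z' s, v⟫ + B (z s) v
          + (Ncs (u s) (U s) v (z s) - Nes (u s) (U s) v (z s)) = ⟪q s, v⟫) :
    (∫ s in a..b, ⟪q s, u s⟫) - (∫ s in a..b, ⟪q s, U s⟫)
      = (⟪z a, u a - x⟫ - ⟪z b, u b - y⟫)
        + (b - a) * (⟪c, w⟫ - ⟪(b - a)⁻¹ • (y - x), w⟫ - B y w - Nc y w + Ne x w)
        + (∫ s in a..b, ((⟪f s, z s - w⟫ - ⟪(b - a)⁻¹ • (y - x), z s - w⟫
              - B (U s) (z s - w) - (Nc (U s) (z s - w) - Ne (U s) (z s - w)))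
            + (B y w + Nc y w - Ne x w - B (U s) w - (Nc (U s) w - Ne (U s) w))))
        + ∫ s in a..b, ⟪f s - c, w⟫ := by
  have hba : b - a ≠ 0 := sub_ne_zero.2 hab.ne'
  have huIcc : Set.uIcc a b = Set.Icc a b := Set.uIcc_of_le hab.le
  have hcu : ContinuousOn u (Set.Icc a b) := fun s hs => (hu s hs).continuousAt.continuousWithinAt
  have hcz : ContinuousOn z (Set.Icc a b) := fun s hs => (hz s hs).continuousAt.continuousWithinAt
  have hcU : ContinuousOn U (Set.Icc a b) := by
    refine ContinuousOn.congr (Continuous.continuousOn ?_) hU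
    fun_prop
  have hint : ∀ {g : ℝ → ℝ}, ContinuousOn g (Set.Icc a b) → IntervalIntegrable g volume a b :=
    fun hg => (huIcc ▸ hg).intervalIntegrable
  have hcomp : ∀ {F : H → H → ℝ}, (Continuous fun p : H × H => F p.1 p.2) →
      ∀ {g h : ℝ → H}, ContinuousOn g (Set.Icc a b) → ContinuousOn h (Set.Icc a b) →
      ContinuousOn (fun s => F (g s) (h s)) (Set.Icc a b) :=
    fun hF _ _ hg hh => hF.comp_continuousOn (hg.prodMk hh)
  have hzw : ContinuousOn (fun s => z s - w) (Set.Icc a b) := hcz.sub continuousOn_const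
  have hcw : ContinuousOn (fun _ : ℝ => w) (Set.Icc a b) := continuousOn_const
  have hiu := hint (hq.inner hcu (𝕜 := ℝ))
  have hiU := hint (hq.inner hcU (𝕜 := ℝ))
  have hio : IntervalIntegrable (fun s => ⟪f s - c, w⟫) volume a b :=
    hint ((hf.sub (continuousOn_const (c := c))).inner hcw (𝕜 := ℝ))
  have hbig : IntervalIntegrable (fun s =>
      (⟪f s, z s - w⟫ - ⟪(b - a)⁻¹ • (y - x), z s - w⟫
          - B (U s) (z s - w) - (Nc (U s) (z s - w) - Ne (U s) (z s - w)))
        + (B y w + Nc y w - Ne x w - B (U s) w - (Nc (U s) w - Ne (U s) w))) volume a b :=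
    hint ((((((hf.inner hzw (𝕜 := ℝ)).sub
    ((continuousOn_const (c := (b - a)⁻¹ • (y - x))).inner hzw (𝕜 := ℝ))).sub
    (hcomp hB_cont hcU hzw)).sub ((hcomp hNc_cont hcU hzw).sub (hcomp hNe_cont hcU hzw)))).add
    (((continuousOn_const (c := B y w + Nc y w - Ne x w)).sub (hcomp hB_cont hcU hcw)).sub
      ((hcomp hNc_cont hcU hcw).sub (hcomp hNe_cont hcU hcw))))
  let L : ℝ → H := fun s => ((b - s) / (b - a)) • x + ((s - a) / (b - a)) • y
  have hL : ∀ s, HasDerivAt L ((b - a)⁻¹ • (y - x)) s := by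
    intro s
    have h1 : HasDerivAt (fun s : ℝ => (b - s) / (b - a)) (-1 / (b - a)) s :=
      ((hasDerivAt_id s).const_sub b).div_const _
    have h2 : HasDerivAt (fun s : ℝ => (s - a) / (b - a)) (1 / (b - a)) s :=
      ((hasDerivAt_id s).sub_const a).div_const _
    refine ((h1.smul_const x).add (h2.smul_const y)).congr_deriv ?_
    rw [neg_div, one_div, neg_smul, smul_sub]
    abel
  have hcL : ContinuousOn L (Set.Icc a b) := fun s _ => (hL s).continuousAt.continuousWithinAt
  have hD : IntervalIntegrable (fun s =>
      ⟪z s, u' s - (b - a)⁻¹ • (y - x)⟫ + ⟪z' s, u s - L s⟫) volume a b :=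
    hint (((hcz.inner (hu'.sub
    (continuousOn_const (c := (b - a)⁻¹ • (y - x)))) (𝕜 := ℝ))).add
      (hz'.inner (hcu.sub hcL) (𝕜 := ℝ)))
  have hFTC := intervalIntegral.integral_eq_sub_of_hasDerivAt
    (f := fun s => ⟪z s, u s - L s⟫)
    (fun s hs => ((hz s (huIcc ▸ hs)).inner ℝ ((hu s (huIcc ▸ hs)).sub (hL s)))) hD
  have hDneg : IntervalIntegrable (fun s =>
      -(⟪z s, u' s - (b - a)⁻¹ • (y - x)⟫ + ⟪z' s, u s - L s⟫)) volume a b := hD.neg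
  have hLa : L a = x := by simp [L, hba]
  have hLb : L b = y := by simp [L, hba]
  simp only [hLa, hLb] at hFTC
  have hconst : (b - a) * (⟪c, w⟫ - ⟪(b - a)⁻¹ • (y - x), w⟫ - B y w - Nc y w + Ne x w)
      = ∫ _ in a..b, (⟪c, w⟫ - ⟪(b - a)⁻¹ • (y - x), w⟫ - B y w - Nc y w + Ne x w) := by
    rw [intervalIntegral.integral_const, smul_eq_mul]
  rw [← neg_sub ⟪z b, u b - y⟫, ← hFTC, hconst, ← intervalIntegral.integral_sub hiu hiU,
    ← intervalIntegral.integral_neg,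
    ← intervalIntegral.integral_add hDneg intervalIntegrable_const,
    ← intervalIntegral.integral_add (hDneg.add intervalIntegrable_const) hbig,
    ← intervalIntegral.integral_add ((hDneg.add intervalIntegrable_const).add hbig) hio]
  refine intervalIntegral.integral_congr fun s hs => ?_
  rw [huIcc] at hs
  have hLU : L s = U s := (hU s hs).symm
  have hd := hdual s hs (u s - U s)
  have hp := hprimal s hs (z s)
  rw [hNcs_mvl, hNes_mvl, hB_sub, hB_symm (z s), hB_symm (z s)] at hd
  simp only [hLU, hB_sub, hNc_sub, hNe_sub, inner_sub_left, inner_sub_right] at hd ⊢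
  simp only [real_inner_comm (z s)] at hd hp ⊢
  linarith

/-- Decomposed error representation: for the IMEX–Galerkin full discretization of a
semi-linear parabolic problem, the error in the quantity of interest decomposes as
`Q(u) - Q(I u_τh) = R_s + R_t + Osc`, with spatial error representation `R_s`, temporal
error representation `R_t` and data-oscillation contribution `Osc`. -/
theorem decomposed_error_representation
    {H : Type*} [NormedAddCommGroup H] [InnerProductSpace ℝ H] [CompleteSpace H]
    (B Nc Ne : H → H → ℝ) (Ncs Nes : H → H → H → H → ℝ)
    (hB_cont : Continuous fun p : H × H => B p.1 p.2)
    (hB_symm : ∀ a b : H, B a b = B b a)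
    (hB_add : ∀ a b v : H, B (a + b) v = B a v + B b v)
    (hB_smul : ∀ (c : ℝ) (a v : H), B (c • a) v = c * B a v)
    (hNc_cont : Continuous fun p : H × H => Nc p.1 p.2)
    (hNe_cont : Continuous fun p : H × H => Ne p.1 p.2)
    (hNc_add : ∀ u v w : H, Nc u (v + w) = Nc u v + Nc u w)
    (hNc_smul : ∀ (u : H) (c : ℝ) (v : H), Nc u (c • v) = c * Nc u v)
    (hNe_add : ∀ u v w : H, Ne u (v + w) = Ne u v + Ne u w)
    (hNe_smul : ∀ (u : H) (c : ℝ) (v : H), Ne u (c • v) = c * Ne u v)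
    (hNcs_cont : Continuous fun p : (H × H) × H × H => Ncs p.1.1 p.1.2 p.2.1 p.2.2)
    (hNes_cont : Continuous fun p : (H × H) × H × H => Nes p.1.1 p.1.2 p.2.1 p.2.2)
    (hNcs_addw : ∀ a b w₁ w₂ v : H, Ncs a b (w₁ + w₂) v = Ncs a b w₁ v + Ncs a b w₂ v)
    (hNcs_smulw : ∀ (a b : H) (c : ℝ) (w v : H), Ncs a b (c • w) v = c * Ncs a b w v)
    (hNcs_addv : ∀ a b w v₁ v₂ : H, Ncs a b w (v₁ + v₂) = Ncs a b w v₁ + Ncs a b w v₂)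
    (hNcs_smulv : ∀ (a b : H) (c : ℝ) (w v : H), Ncs a b w (c • v) = c * Ncs a b w v)
    (hNes_addw : ∀ a b w₁ w₂ v : H, Nes a b (w₁ + w₂) v = Nes a b w₁ v + Nes a b w₂ v)
    (hNes_smulw : ∀ (a b : H) (c : ℝ) (w v : H), Nes a b (c • w) v = c * Nes a b w v)
    (hNes_addv : ∀ a b w v₁ v₂ : H, Nes a b w (v₁ + v₂) = Nes a b w v₁ + Nes a b w v₂)
    (hNes_smulv : ∀ (a b : H) (c : ℝ) (w v : H), Nes a b w (c • v) = c * Nes a b w v)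
    (hNcs_mvl : ∀ a b v : H, Ncs a b (a - b) v = Nc a v - Nc b v)
    (hNes_mvl : ∀ a b v : H, Nes a b (a - b) v = Ne a v - Ne b v)
    (T : ℝ) (hT : 0 < T)
    (N : ℕ) (hN : 1 ≤ N)
    (t : ℕ → ℝ) (ht0 : t 0 = 0) (htT : t N = T)
    (ht : ∀ k < N, t k < t (k + 1))
    (qbar : H) (q : ℝ → H) (hq : ContinuousOn q (Set.Icc 0 T))
    (hatN : ℕ → ℝ → ℝ)
    (hhat : ∀ k ≤ N, ∀ s : ℝ,
      hatN k s =
        if k < N ∧ s ∈ Set.Icc (t k) (t (k + 1)) then (t (k + 1) - s) / (t (k + 1) - t k)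
        else if 1 ≤ k ∧ s ∈ Set.Icc (t (k - 1)) (t k) then (s - t (k - 1)) / (t k - t (k - 1))
        else 0)
    (qd : ℕ → H)
    (hqd0 : qd 0 = (t 1 - t 0)⁻¹ • ∫ s in (0:ℝ)..T, hatN 0 s • q s)
    (hqdk : ∀ k, 1 ≤ k → k ≤ N →
      qd k = (t k - t (k - 1))⁻¹ • ∫ s in (0:ℝ)..T, hatN k s • q s)
    (S : ℕ → Submodule ℝ H) (hS : ∀ k ≤ N, IsClosed (S k : Set H))
    (u0 : H) (f : ℝ → H) (hf : ContinuousOn f (Set.Icc 0 T))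
    (ud : ℕ → H)
    (hud0 : ∀ v : H, ⟪ud 0, v⟫ = ⟪u0, v⟫)
    (hud : ∀ k < N, ∀ v : H,
      ⟪(t (k + 1) - t k)⁻¹ • (ud (k + 1) - ud k), v⟫ + B (ud (k + 1)) v
        + Nc (ud (k + 1)) v - Ne (ud k) v = ⟪f (t (k + 1)), v⟫)
    (uh : ℕ → H) (huh_mem : ∀ k ≤ N, uh k ∈ S k)
    (huh0 : ∀ v ∈ S 0, ⟪uh 0, v⟫ = ⟪u0, v⟫)
    (huh : ∀ k < N, ∀ v ∈ S (k + 1),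
      ⟪(t (k + 1) - t k)⁻¹ • (uh (k + 1) - uh k), v⟫ + B (uh (k + 1)) v
        + Nc (uh (k + 1)) v - Ne (uh k) v = ⟪f (t (k + 1)), v⟫)
    (Iuh : ℝ → H)
    (hIuh : ∀ k < N, ∀ s ∈ Set.Icc (t k) (t (k + 1)),
      Iuh s = ((t (k + 1) - s) / (t (k + 1) - t k)) • uh k
        + ((s - t k) / (t (k + 1) - t k)) • uh (k + 1))
    (uc uc' zc zc' : ℝ → H)
    (huc : ∀ s ∈ Set.Icc (0:ℝ) T, HasDerivAt uc (uc' s) s)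
    (huc' : ContinuousOn uc' (Set.Icc 0 T))
    (huc0 : uc 0 = u0)
    (hprimal : ∀ s ∈ Set.Icc (0:ℝ) T, ∀ v : H,
      ⟪uc' s, v⟫ + B (uc s) v + (Nc (uc s) v - Ne (uc s) v) = ⟪f s, v⟫)
    (hzc : ∀ s ∈ Set.Icc (0:ℝ) T, HasDerivAt zc (zc' s) s)
    (hzc' : ContinuousOn zc' (Set.Icc 0 T))
    (hzcT : zc T = qbar)
    (hdual : ∀ s ∈ Set.Icc (0:ℝ) T, ∀ w : H,
      -⟪zc' s, w⟫ + B (zc s) w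
          + (Ncs (uc s) (Iuh s) w (zc s) - Nes (uc s) (Iuh s) w (zc s)) = ⟪q s, w⟫)
    (zd : ℕ → H)
    (hzd0 : ∀ w : H,
      -⟪(t 1 - t 0)⁻¹ • (zd 1 - zd 0), w⟫ - Nes (ud 0) (uh 0) w (zd 1) = ⟪qd 0, w⟫)
    (hzdk : ∀ k, 1 ≤ k → k < N → ∀ w : H,
      -⟪(t k - t (k - 1))⁻¹ • (zd (k + 1) - zd k), w⟫ + B (zd k) w
          + Ncs (ud k) (uh k) w (zd k)
          - ((t (k + 1) - t k) / (t k - t (k - 1))) * Nes (ud k) (uh k) w (zd (k + 1))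
        = ⟪qd k, w⟫)
    (hzdN : ∀ w : H,
      ⟪zd N, w⟫ + (t N - t (N - 1)) * B (zd N) w
          + (t N - t (N - 1)) * Ncs (ud N) (uh N) w (zd N)
        = (t N - t (N - 1)) * ⟪qd N, w⟫ + ⟪qbar, w⟫) :
    ∀ vh : ℕ → H, (∀ k ≤ N, vh k ∈ S k) →
      (⟪qbar, uc T⟫ + ∫ s in (0:ℝ)..T, ⟪q s, uc s⟫)
          - (⟪qbar, Iuh T⟫ + ∫ s in (0:ℝ)..T, ⟪q s, Iuh s⟫)
        = (⟪u0 - uh 0, zd 0 - vh 0⟫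
            + ∑ k ∈ Finset.Icc 1 N,
                (t k - t (k - 1)) *
                  (⟪f (t k), zd k - vh k⟫
                    - ⟪(t k - t (k - 1))⁻¹ • (uh k - uh (k - 1)), zd k - vh k⟫
                    - B (uh k) (zd k - vh k) - Nc (uh k) (zd k - vh k)
                    + Ne (uh (k - 1)) (zd k - vh k)))
          + (⟪u0 - uh 0, zc 0 - zd 0⟫
              + ∑ k ∈ Finset.range N,
                  ∫ s in (t k)..(t (k + 1)),
                    ((⟪f s, zc s - zd (k + 1)⟫
                        - ⟪(t (k + 1) - t k)⁻¹ • (uh (k + 1) - uh k), zc s - zd (k + 1)⟫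
                        - B (Iuh s) (zc s - zd (k + 1))
                        - (Nc (Iuh s) (zc s - zd (k + 1)) - Ne (Iuh s) (zc s - zd (k + 1))))
                      + (B (uh (k + 1)) (zd (k + 1)) + Nc (uh (k + 1)) (zd (k + 1))
                          - Ne (uh k) (zd (k + 1)) - B (Iuh s) (zd (k + 1))
                          - (Nc (Iuh s) (zd (k + 1)) - Ne (Iuh s) (zd (k + 1))))))
          + ∑ k ∈ Finset.range N,
              ∫ s in (t k)..(t (k + 1)), ⟪f s - f (t (k + 1)), zd (k + 1)⟫ := by
  intro vh hvh
  have hB_sub : ∀ x v w : H, B x (v - w) = B x v - B x w := fun x v w => by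
    rw [sub_eq_add_neg, ← neg_one_smul ℝ w, hB_symm, hB_add, hB_smul, hB_symm v, hB_symm w]
    ring
  have hNc_sub : ∀ x v w : H, Nc x (v - w) = Nc x v - Nc x w := fun x v w => by
    rw [sub_eq_add_neg, ← neg_one_smul ℝ w, hNc_add, hNc_smul]
    ring
  have hNe_sub : ∀ x v w : H, Ne x (v - w) = Ne x v - Ne x w := fun x v w => by
    rw [sub_eq_add_neg, ← neg_one_smul ℝ w, hNe_add, hNe_smul]
    ring
  have hmono : ∀ m ≤ N, ∀ k ≤ m, t k ≤ t m := by
    intro m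
    induction m with
    | zero => intro _ k hk; rw [Nat.le_zero.1 hk]
    | succ m ih =>
      intro hm k hk
      rcases hk.lt_or_eq with h | h
      · exact (ih (by omega) k (by omega)).trans (ht m (by omega)).le
      · rw [h]
  have hsub : ∀ k < N, Set.Icc (t k) (t (k + 1)) ⊆ Set.Icc 0 T := fun k hk =>
    Set.Icc_subset_Icc (ht0 ▸ hmono k hk.le 0 (Nat.zero_le k)) (htT ▸ hmono N le_rfl (k + 1) hk)
  have hstep := fun k (hk : k < N) => error_identity_on_step hB_cont hB_symm hB_sub hNc_cont
    hNe_cont hNc_sub hNe_sub hNcs_mvl hNes_mvl (ht k hk) (f (t (k + 1))) (zd (k + 1))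
    (hq.mono (hsub k hk)) (hf.mono (hsub k hk)) (hIuh k hk)
    (fun s hs => huc s (hsub k hk hs)) (huc'.mono (hsub k hk))
    (fun s hs => hzc s (hsub k hk hs)) (hzc'.mono (hsub k hk))
    (fun s hs => hprimal s (hsub k hk hs)) (fun s hs => hdual s (hsub k hk hs))
  have hsplit : ∀ g : ℝ → H, (∀ k < N, ContinuousOn g (Set.Icc (t k) (t (k + 1)))) →
      ∫ s in (0:ℝ)..T, ⟪q s, g s⟫
        = ∑ k ∈ Finset.range N, ∫ s in (t k)..(t (k + 1)), ⟪q s, g s⟫ := by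
    intro g hg
    rw [intervalIntegral.sum_integral_adjacent_intervals, ht0, htT]
    intro k hk
    refine ContinuousOn.intervalIntegrable ?_
    rw [Set.uIcc_of_le (ht k hk).le]
    exact (hq.mono (hsub k hk)).inner (hg k hk)
  have hIcc : ∀ (g : ℕ → ℝ), ∑ k ∈ Finset.Icc 1 N, g k = ∑ k ∈ Finset.range N, g (k + 1) :=
    fun g => by rw [Finset.range_eq_Ico, Finset.sum_Ico_add', zero_add]; rfl
  have hIT : Iuh T = uh N := by
    obtain ⟨M, rfl⟩ : ∃ M, N = M + 1 := ⟨N - 1, by omega⟩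
    have hM := ht M M.lt_succ_self
    have hne : t (M + 1) - t M ≠ 0 := sub_ne_zero.2 hM.ne'
    rw [← htT, hIuh M M.lt_succ_self _ (Set.right_mem_Icc.2 hM.le)]
    simp [hne]
  have horth : ⟪u0 - uh 0, zd 0 - vh 0⟫ = ⟪u0 - uh 0, zd 0⟫ := by
    have h0 := huh0 (vh 0) (hvh 0 (Nat.zero_le N))
    rw [inner_sub_right, inner_sub_left u0 (uh 0) (vh 0), h0]
    ring
  rw [hsplit uc fun k hk s hs =>
      (huc s (hsub k hk hs)).continuousAt.continuousWithinAt,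
    hsplit Iuh fun k hk => ContinuousOn.congr (Continuous.continuousOn (by fun_prop)) (hIuh k hk),
    hIcc, horth, add_sub_add_comm, ← Finset.sum_sub_distrib,
    Finset.sum_congr rfl fun k hk => hstep k (Finset.mem_range.1 hk)]
  simp only [Finset.sum_add_distrib]
  rw [Finset.sum_range_sub' fun k => ⟪zc (t k), uc (t k) - uh k⟫, ht0, htT, huc0, hzcT, hIT]
  have hres : ∑ k ∈ Finset.range N, (t (k + 1) - t (k + 1 - 1)) *
        (⟪f (t (k + 1)), zd (k + 1) - vh (k + 1)⟫
          - ⟪(t (k + 1) - t (k + 1 - 1))⁻¹ • (uh (k + 1) - uh (k + 1 - 1)),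
              zd (k + 1) - vh (k + 1)⟫
          - B (uh (k + 1)) (zd (k + 1) - vh (k + 1)) - Nc (uh (k + 1)) (zd (k + 1) - vh (k + 1))
          + Ne (uh (k + 1 - 1)) (zd (k + 1) - vh (k + 1)))
      = ∑ k ∈ Finset.range N, (t (k + 1) - t k) *
        (⟪f (t (k + 1)), zd (k + 1)⟫
          - ⟪(t (k + 1) - t k)⁻¹ • (uh (k + 1) - uh k), zd (k + 1)⟫
          - B (uh (k + 1)) (zd (k + 1)) - Nc (uh (k + 1)) (zd (k + 1))
          + Ne (uh k) (zd (k + 1))) := by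
    refine Finset.sum_congr rfl fun k hk => ?_
    have hk := Finset.mem_range.1 hk
    have ho := huh k hk (vh (k + 1)) (hvh (k + 1) hk)
    simp only [Nat.add_sub_cancel, hB_sub, hNc_sub, hNe_sub, inner_sub_right] at ho ⊢
    congr 1
    linarith
  rw [hres, real_inner_comm (u0 - uh 0) (zc 0)]
  simp only [inner_sub_right]
  ring
end

section
/- Under the assumptions of the decomposed error representation (u a continuously differentiable primal solution with u(0) = u⁰, f continuous with f_k := f(t_k), u₀, …, u_N the time-discrete IMEX primal solution, u₀^h, …, u_N^h the fully discrete IMEX–Galerkin solution, z a continuously differentiable solution of the dual problem linearized between u and I u_τh with z(T) = q̄, and z₀, …, z_N the IMEX time-discrete dual solution with data q_k given by hat-function averages of q), the error with respect to the time-discrete solution equals the temporal error representation plus the data oscillation: Q(u) − Q(I u_τ) = R_t + Osc, where I u_τ is the piecewise-linear time reconstruction of u₀, …, u_N, R_t := (u⁰ − u₀^h, z(0) − z₀) + Σ_{k=0}^{N−1} ∫_{t_k}^{t_{k+1}} [ R_PDE(I u_τh(t); z(t) − z_{k+1}) + ⟨r_τ^{k+1}(t), z_{k+1}⟩ ] dt,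 and Osc := Σ_{k=0}^{N−1} ∫_{t_k}^{t_{k+1}} (f(t) − f_{k+1}, z_{k+1}) dt. -/
open MeasureTheory RealInnerProductSpace

/-- An additive real-valued map respects subtraction. -/
lemma additive_map_sub {H : Type*} [AddCommGroup H] {g : H → ℝ}
    (hg : ∀ a b, g (a + b) = g a + g b) (a b : H) : g (a - b) = g a - g b := by
  have h := hg (a - b) b
  rw [sub_add_cancel] at h
  linarith

/-- Integration by parts against a pointwise dual identity. -/
lemma integral_inner_eq_of_dual_identity
    {H : Type*} [NormedAddCommGroup H] [InnerProductSpace ℝ H]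
    {a b : ℝ} (hab : a ≤ b) {q e e' z z' : ℝ → H} {ρ : ℝ → ℝ}
    (he : ∀ s ∈ Set.Icc a b, HasDerivAt e (e' s) s)
    (hz : ∀ s ∈ Set.Icc a b, HasDerivAt z (z' s) s)
    (he' : ContinuousOn e' (Set.Icc a b)) (hz' : ContinuousOn z' (Set.Icc a b))
    (hq : ContinuousOn q (Set.Icc a b))
    (h : ∀ s ∈ Set.Icc a b, ⟪q s, e s⟫ = ρ s - (⟪z s, e' s⟫ + ⟪z' s, e s⟫)) :
    IntervalIntegrable ρ volume a b ∧
      ∫ s in a..b, ⟪q s, e s⟫ = (∫ s in a..b, ρ s) + ⟪z a, e a⟫ - ⟪z b, e b⟫ := by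
  have hce : ContinuousOn e (Set.Icc a b) := fun s hs => (he s hs).continuousAt.continuousWithinAt
  have hcz : ContinuousOn z (Set.Icc a b) := fun s hs => (hz s hs).continuousAt.continuousWithinAt
  have hd : ContinuousOn (fun s => ⟪z s, e' s⟫ + ⟪z' s, e s⟫) (Set.Icc a b) :=
    (hcz.inner he').add (hz'.inner hce)
  have hρ : ContinuousOn ρ (Set.Icc a b) :=
    ((hq.inner hce).add hd).congr fun s hs => by
      have := h s hs
      simp only [Pi.add_apply]
      linarith
  have hρi : IntervalIntegrable ρ volume a b := hρ.intervalIntegrable_of_Icc hab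
  have hdi := hd.intervalIntegrable_of_Icc (μ := volume) hab
  have ftc : ∫ s in a..b, (⟪z s, e' s⟫ + ⟪z' s, e s⟫) = ⟪z b, e b⟫ - ⟪z a, e a⟫ := by
    refine intervalIntegral.integral_eq_sub_of_hasDerivAt
      (f := fun s => ⟪z s, e s⟫) (fun s hs => ?_) hdi
    rw [Set.uIcc_of_le hab] at hs
    exact (hz s hs).inner ℝ (he s hs)
  refine ⟨hρi, ?_⟩
  have hcongr : ∫ s in a..b, ⟪q s, e s⟫ = ∫ s in a..b, (ρ s - (⟪z s, e' s⟫ + ⟪z' s, e s⟫)) :=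
    intervalIntegral.integral_congr fun s hs => h s (by rwa [Set.uIcc_of_le hab] at hs)
  rw [hcongr, intervalIntegral.integral_sub hρi hdi, ftc]
  ring

/-- Summation by parts for inner products. -/
lemma inner_summation_by_parts {H : Type*} [NormedAddCommGroup H] [InnerProductSpace ℝ H]
    (z e : ℕ → H) (N : ℕ) :
    ∑ k ∈ Finset.range N, -⟪z (k + 1) - z k, e k⟫ + ⟪z N, e N⟫
      = ⟪z 0, e 0⟫ + ∑ k ∈ Finset.range N, ⟪z (k + 1), e (k + 1) - e k⟫ := by
  induction N with
  | zero => simp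
  | succ n ih =>
    rw [Finset.sum_range_succ, Finset.sum_range_succ, inner_sub_left, inner_sub_right]
    linarith

/-- The nodes of a partition are ordered. -/
lemma partition_mono {N : ℕ} {t : ℕ → ℝ} (ht : ∀ k < N, t k < t (k + 1))
    {i j : ℕ} (hij : i ≤ j) (hj : j ≤ N) : t i ≤ t j := by
  induction j, hij using Nat.le_induction with
  | base => exact le_rfl
  | succ n _ ih => exact (ih (by omega)).trans (ht n (by omega)).le

/-- The weighted integral against a hat function is the sum of its two local contributions. -/
lemma integral_hat_smul
    {H : Type*} [NormedAddCommGroup H] [InnerProductSpace ℝ H]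
    {N : ℕ} {t : ℕ → ℝ} (ht : ∀ k < N, t k < t (k + 1))
    {q : ℝ → H} (hq : ContinuousOn q (Set.Icc (t 0) (t N)))
    {hatN : ℕ → ℝ → ℝ}
    (hhat : ∀ k ≤ N, ∀ s : ℝ,
      hatN k s =
        if k < N ∧ s ∈ Set.Icc (t k) (t (k + 1)) then (t (k + 1) - s) / (t (k + 1) - t k)
        else if 1 ≤ k ∧ s ∈ Set.Icc (t (k - 1)) (t k) then (s - t (k - 1)) / (t k - t (k - 1))
        else 0)
    {k : ℕ} (hk : k ≤ N) :
    ∫ s in (t 0)..(t N), hatN k s • q s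
      = (if k < N then ∫ s in (t k)..(t (k + 1)), ((t (k + 1) - s) / (t (k + 1) - t k)) • q s
          else 0)
        + (if 1 ≤ k then ∫ s in (t (k - 1))..(t k), ((s - t (k - 1)) / (t k - t (k - 1))) • q s
          else 0) := by
  have hqj : ∀ j < N, ContinuousOn q (Set.Icc (t j) (t (j + 1))) := fun j hj =>
    hq.mono (Set.Icc_subset_Icc (partition_mono ht (Nat.zero_le j) hj.le)
      (partition_mono ht hj le_rfl))
  set F : ℕ → ℝ → H := fun j s =>
    (if j = k then ((t (k + 1) - s) / (t (k + 1) - t k)) • q s else 0)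
      + (if j + 1 = k then ((s - t (k - 1)) / (t k - t (k - 1))) • q s else 0) with hF
  have hFcont : ∀ j < N, ContinuousOn (F j) (Set.Icc (t j) (t (j + 1))) := by
    intro j hj
    have := hqj j hj
    simp only [hF]
    split_ifs <;> fun_prop
  have hloc : ∀ j < N, ∀ s ∈ Set.Ioo (t j) (t (j + 1)), hatN k s • q s = F j s := by
    intro j hj s hs
    have key : ∀ i < N, s ∈ Set.Icc (t i) (t (i + 1)) → i = j := by
      intro i hi hsi
      rcases lt_trichotomy i j with h | h | h
      · have := partition_mono ht (show i + 1 ≤ j from h) hj.le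
        linarith [hs.1, hsi.2]
      · exact h
      · have := partition_mono ht (show j + 1 ≤ i from h) hi.le
        linarith [hs.2, hsi.1]
    have hsI : s ∈ Set.Icc (t j) (t (j + 1)) := ⟨hs.1.le, hs.2.le⟩
    rw [hhat k hk s]
    simp only [hF]
    by_cases h1 : j = k
    · subst h1
      simp [hj, hsI]
    · have n1 : ¬ (k < N ∧ s ∈ Set.Icc (t k) (t (k + 1))) := fun h => h1 (key k h.1 h.2).symm
      rw [if_neg n1, if_neg h1]
      by_cases h2 : j + 1 = k
      · subst h2
        simp [hsI]
      · have n2 : ¬ (1 ≤ k ∧ s ∈ Set.Icc (t (k - 1)) (t k)) := by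
          rintro ⟨h3, h4⟩
          have h5 := key (k - 1) (by omega) (by rwa [Nat.sub_add_cancel h3])
          omega
        rw [if_neg n2, if_neg h2]
        simp
  have hint : ∀ j < N, IntervalIntegrable (fun s => hatN k s • q s) volume (t j) (t (j + 1)) := by
    intro j hj
    refine ((hFcont j hj).intervalIntegrable_of_Icc (ht j hj).le).congr_uIoo ?_
    rw [Set.uIoo_of_le (ht j hj).le]
    exact fun s hs => (hloc j hj s hs).symm
  rw [← intervalIntegral.sum_integral_adjacent_intervals hint]
  have hsum : ∀ j ∈ Finset.range N, ∫ s in (t j)..(t (j + 1)), hatN k s • q s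
      = (if j = k then ∫ s in (t k)..(t (k + 1)), ((t (k + 1) - s) / (t (k + 1) - t k)) • q s
          else 0)
        + (if j + 1 = k then
            ∫ s in (t (k - 1))..(t k), ((s - t (k - 1)) / (t k - t (k - 1))) • q s else 0) := by
    intro j hj
    have hj := Finset.mem_range.1 hj
    have h1 : ∫ s in (t j)..(t (j + 1)), hatN k s • q s = ∫ s in (t j)..(t (j + 1)), F j s := by
      refine intervalIntegral.integral_congr_uIoo ?_
      rw [Set.uIoo_of_le (ht j hj).le]
      exact fun s hs => hloc j hj s hs
    rw [h1]
    by_cases h1 : j = k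
    · subst h1
      simp [hF]
    · by_cases h2 : j + 1 = k
      · subst h2
        simp [hF]
      · simp [hF, h1, h2]
  rw [Finset.sum_congr rfl hsum, Finset.sum_add_distrib]
  congr 1
  · simp
  · split_ifs with h
    · rw [Finset.sum_eq_single (k - 1)]
      · rw [if_pos (by omega)]
      · intro j _ hj
        rw [if_neg (by omega)]
      · intro h'
        exact absurd (Finset.mem_range.2 (by omega)) h'
    · exact Finset.sum_eq_zero fun j _ => if_neg (by omega)

/-- Integrating against a piecewise-linear function amounts to pairing its nodal values with
the hat-function averages. -/
lemma sum_integral_inner_piecewise_linear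
    {H : Type*} [NormedAddCommGroup H] [InnerProductSpace ℝ H] [CompleteSpace H]
    {N : ℕ} (hN : 1 ≤ N) {t : ℕ → ℝ} (ht : ∀ k < N, t k < t (k + 1))
    {q : ℝ → H} (hq : ContinuousOn q (Set.Icc (t 0) (t N)))
    {hatN : ℕ → ℝ → ℝ}
    (hhat : ∀ k ≤ N, ∀ s : ℝ,
      hatN k s =
        if k < N ∧ s ∈ Set.Icc (t k) (t (k + 1)) then (t (k + 1) - s) / (t (k + 1) - t k)
        else if 1 ≤ k ∧ s ∈ Set.Icc (t (k - 1)) (t k) then (s - t (k - 1)) / (t k - t (k - 1))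
        else 0)
    {qd : ℕ → H}
    (hqd0 : qd 0 = (t 1 - t 0)⁻¹ • ∫ s in (t 0)..(t N), hatN 0 s • q s)
    (hqdk : ∀ k, 1 ≤ k → k ≤ N →
      qd k = (t k - t (k - 1))⁻¹ • ∫ s in (t 0)..(t N), hatN k s • q s)
    (e : ℕ → H) :
    ∑ k ∈ Finset.range N, ∫ s in (t k)..(t (k + 1)),
        ⟪q s, ((t (k + 1) - s) / (t (k + 1) - t k)) • e k
          + ((s - t k) / (t (k + 1) - t k)) • e (k + 1)⟫
      = (t 1 - t 0) * ⟪qd 0, e 0⟫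
        + ∑ k ∈ Finset.range N, (t (k + 1) - t k) * ⟪qd (k + 1), e (k + 1)⟫ := by
  set A : ℕ → H := fun k =>
    ∫ s in (t k)..(t (k + 1)), ((t (k + 1) - s) / (t (k + 1) - t k)) • q s with hA
  set C : ℕ → H := fun k =>
    ∫ s in (t k)..(t (k + 1)), ((s - t k) / (t (k + 1) - t k)) • q s with hC
  have hloc : ∀ k ∈ Finset.range N, ∫ s in (t k)..(t (k + 1)),
        ⟪q s, ((t (k + 1) - s) / (t (k + 1) - t k)) • e k
          + ((s - t k) / (t (k + 1) - t k)) • e (k + 1)⟫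
      = ⟪A k, e k⟫ + ⟪C k, e (k + 1)⟫ := by
    intro k hk
    have hk := Finset.mem_range.1 hk
    have hqk : ContinuousOn q (Set.Icc (t k) (t (k + 1))) :=
      hq.mono (Set.Icc_subset_Icc (partition_mono ht (Nat.zero_le k) hk.le)
        (partition_mono ht hk le_rfl))
    have h1 : IntervalIntegrable (fun s => ((t (k + 1) - s) / (t (k + 1) - t k)) • q s)
        volume (t k) (t (k + 1)) :=
      ContinuousOn.intervalIntegrable_of_Icc (ht k hk).le (by fun_prop)
    have h2 : IntervalIntegrable (fun s => ((s - t k) / (t (k + 1) - t k)) • q s)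
        volume (t k) (t (k + 1)) :=
      ContinuousOn.intervalIntegrable_of_Icc (ht k hk).le (by fun_prop)
    have e1 : ⟪A k, e k⟫
        = ∫ s in (t k)..(t (k + 1)), ⟪e k, ((t (k + 1) - s) / (t (k + 1) - t k)) • q s⟫ := by
      rw [real_inner_comm]
      exact ((innerSL ℝ (e k)).intervalIntegral_comp_comm h1).symm
    have e2 : ⟪C k, e (k + 1)⟫
        = ∫ s in (t k)..(t (k + 1)), ⟪e (k + 1), ((s - t k) / (t (k + 1) - t k)) • q s⟫ := by
      rw [real_inner_comm]
      exact ((innerSL ℝ (e (k + 1))).intervalIntegral_comp_comm h2).symm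
    rw [e1, e2, ← intervalIntegral.integral_add
      (ContinuousOn.intervalIntegrable_of_Icc (ht k hk).le (by fun_prop))
      (ContinuousOn.intervalIntegrable_of_Icc (ht k hk).le (by fun_prop))]
    refine intervalIntegral.integral_congr fun s _ => ?_
    simp only [inner_add_right, inner_smul_right]
    rw [real_inner_comm, real_inner_comm (e (k + 1))]
  rw [Finset.sum_congr rfl hloc]
  have hq0 : (t 1 - t 0) • qd 0 = A 0 := by
    have hpos := sub_pos.2 (ht 0 (by omega))
    rw [zero_add] at hpos
    rw [hqd0, smul_inv_smul₀ hpos.ne', integral_hat_smul ht hq hhat (Nat.zero_le N),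
      if_pos (by omega), if_neg (by omega), add_zero]
  have hqk : ∀ k < N, (t (k + 1) - t k) • qd (k + 1)
      = (if k + 1 < N then A (k + 1) else 0) + C k := by
    intro k hk
    have hpos := sub_pos.2 (ht k hk)
    rw [hqdk (k + 1) (by omega) hk, Nat.add_sub_cancel, smul_inv_smul₀ hpos.ne',
      integral_hat_smul ht hq hhat (show k + 1 ≤ N from hk), if_pos (show 1 ≤ k + 1 by omega),
      Nat.add_sub_cancel]
  have hR : ∑ k ∈ Finset.range N, (t (k + 1) - t k) * ⟪qd (k + 1), e (k + 1)⟫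
      = ∑ k ∈ Finset.range N, (⟪(if k + 1 < N then A (k + 1) else 0), e (k + 1)⟫
          + ⟪C k, e (k + 1)⟫) := by
    refine Finset.sum_congr rfl fun k hk => ?_
    rw [← real_inner_smul_left, hqk k (Finset.mem_range.1 hk), inner_add_left]
  rw [hR, ← real_inner_smul_left, hq0, Finset.sum_add_distrib, Finset.sum_add_distrib, ← add_assoc]
  congr 1
  obtain ⟨M, rfl⟩ : ∃ M, N = M + 1 := ⟨N - 1, by omega⟩
  rw [Finset.sum_range_succ', Finset.sum_range_succ, if_neg (lt_irrefl _), inner_zero_left,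
    add_zero, add_comm]
  congr 1
  refine Finset.sum_congr rfl fun k hk => ?_
  rw [if_pos (by simpa using hk)]

/-- The error with respect to the time-discrete solution equals the temporal error
representation plus the data oscillation: `Q(u) - Q(I u_τ) = R_t + Osc`, where `I u_τ` is
the piecewise-linear time reconstruction of the time-discrete IMEX solution. -/
theorem temporal_error_plus_oscillation_representation
    {H : Type*} [NormedAddCommGroup H] [InnerProductSpace ℝ H] [CompleteSpace H]
    (B Nc Ne : H → H → ℝ) (Ncs Nes : H → H → H → H → ℝ)
    (hB_cont : Continuous fun p : H × H => B p.1 p.2)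
    (hB_symm : ∀ a b : H, B a b = B b a)
    (hB_add : ∀ a b v : H, B (a + b) v = B a v + B b v)
    (hB_smul : ∀ (c : ℝ) (a v : H), B (c • a) v = c * B a v)
    (hNc_cont : Continuous fun p : H × H => Nc p.1 p.2)
    (hNe_cont : Continuous fun p : H × H => Ne p.1 p.2)
    (hNc_add : ∀ u v w : H, Nc u (v + w) = Nc u v + Nc u w)
    (hNc_smul : ∀ (u : H) (c : ℝ) (v : H), Nc u (c • v) = c * Nc u v)
    (hNe_add : ∀ u v w : H, Ne u (v + w) = Ne u v + Ne u w)
    (hNe_smul : ∀ (u : H) (c : ℝ) (v : H), Ne u (c • v) = c * Ne u v)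
    (hNcs_cont : Continuous fun p : (H × H) × H × H => Ncs p.1.1 p.1.2 p.2.1 p.2.2)
    (hNes_cont : Continuous fun p : (H × H) × H × H => Nes p.1.1 p.1.2 p.2.1 p.2.2)
    (hNcs_addw : ∀ a b w₁ w₂ v : H, Ncs a b (w₁ + w₂) v = Ncs a b w₁ v + Ncs a b w₂ v)
    (hNcs_smulw : ∀ (a b : H) (c : ℝ) (w v : H), Ncs a b (c • w) v = c * Ncs a b w v)
    (hNcs_addv : ∀ a b w v₁ v₂ : H, Ncs a b w (v₁ + v₂) = Ncs a b w v₁ + Ncs a b w v₂)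
    (hNcs_smulv : ∀ (a b : H) (c : ℝ) (w v : H), Ncs a b w (c • v) = c * Ncs a b w v)
    (hNes_addw : ∀ a b w₁ w₂ v : H, Nes a b (w₁ + w₂) v = Nes a b w₁ v + Nes a b w₂ v)
    (hNes_smulw : ∀ (a b : H) (c : ℝ) (w v : H), Nes a b (c • w) v = c * Nes a b w v)
    (hNes_addv : ∀ a b w v₁ v₂ : H, Nes a b w (v₁ + v₂) = Nes a b w v₁ + Nes a b w v₂)
    (hNes_smulv : ∀ (a b : H) (c : ℝ) (w v : H), Nes a b w (c • v) = c * Nes a b w v)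
    (hNcs_mvl : ∀ a b v : H, Ncs a b (a - b) v = Nc a v - Nc b v)
    (hNes_mvl : ∀ a b v : H, Nes a b (a - b) v = Ne a v - Ne b v)
    (T : ℝ) (hT : 0 < T)
    (N : ℕ) (hN : 1 ≤ N)
    (t : ℕ → ℝ) (ht0 : t 0 = 0) (htT : t N = T)
    (ht : ∀ k < N, t k < t (k + 1))
    (qbar : H) (q : ℝ → H) (hq : ContinuousOn q (Set.Icc 0 T))
    (hatN : ℕ → ℝ → ℝ)
    (hhat : ∀ k ≤ N, ∀ s : ℝ,
      hatN k s =
        if k < N ∧ s ∈ Set.Icc (t k) (t (k + 1)) then (t (k + 1) - s) / (t (k + 1) - t k)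
        else if 1 ≤ k ∧ s ∈ Set.Icc (t (k - 1)) (t k) then (s - t (k - 1)) / (t k - t (k - 1))
        else 0)
    (qd : ℕ → H)
    (hqd0 : qd 0 = (t 1 - t 0)⁻¹ • ∫ s in (0:ℝ)..T, hatN 0 s • q s)
    (hqdk : ∀ k, 1 ≤ k → k ≤ N →
      qd k = (t k - t (k - 1))⁻¹ • ∫ s in (0:ℝ)..T, hatN k s • q s)
    (S : ℕ → Submodule ℝ H) (hS : ∀ k ≤ N, IsClosed (S k : Set H))
    (u0 : H) (f : ℝ → H) (hf : ContinuousOn f (Set.Icc 0 T))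
    (ud : ℕ → H)
    (hud0 : ∀ v : H, ⟪ud 0, v⟫ = ⟪u0, v⟫)
    (hud : ∀ k < N, ∀ v : H,
      ⟪(t (k + 1) - t k)⁻¹ • (ud (k + 1) - ud k), v⟫ + B (ud (k + 1)) v
        + Nc (ud (k + 1)) v - Ne (ud k) v = ⟪f (t (k + 1)), v⟫)
    (uh : ℕ → H) (huh_mem : ∀ k ≤ N, uh k ∈ S k)
    (huh0 : ∀ v ∈ S 0, ⟪uh 0, v⟫ = ⟪u0, v⟫)
    (huh : ∀ k < N, ∀ v ∈ S (k + 1),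
      ⟪(t (k + 1) - t k)⁻¹ • (uh (k + 1) - uh k), v⟫ + B (uh (k + 1)) v
        + Nc (uh (k + 1)) v - Ne (uh k) v = ⟪f (t (k + 1)), v⟫)
    (Iuh : ℝ → H)
    (hIuh : ∀ k < N, ∀ s ∈ Set.Icc (t k) (t (k + 1)),
      Iuh s = ((t (k + 1) - s) / (t (k + 1) - t k)) • uh k
        + ((s - t k) / (t (k + 1) - t k)) • uh (k + 1))
    (Iut : ℝ → H)
    (hIut : ∀ k < N, ∀ s ∈ Set.Icc (t k) (t (k + 1)),
      Iut s = ((t (k + 1) - s) / (t (k + 1) - t k)) • ud k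
        + ((s - t k) / (t (k + 1) - t k)) • ud (k + 1))
    (uc uc' zc zc' : ℝ → H)
    (huc : ∀ s ∈ Set.Icc (0:ℝ) T, HasDerivAt uc (uc' s) s)
    (huc' : ContinuousOn uc' (Set.Icc 0 T))
    (huc0 : uc 0 = u0)
    (hprimal : ∀ s ∈ Set.Icc (0:ℝ) T, ∀ v : H,
      ⟪uc' s, v⟫ + B (uc s) v + (Nc (uc s) v - Ne (uc s) v) = ⟪f s, v⟫)
    (hzc : ∀ s ∈ Set.Icc (0:ℝ) T, HasDerivAt zc (zc' s) s)
    (hzc' : ContinuousOn zc' (Set.Icc 0 T))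
    (hzcT : zc T = qbar)
    (hdual : ∀ s ∈ Set.Icc (0:ℝ) T, ∀ w : H,
      -⟪zc' s, w⟫ + B (zc s) w
          + (Ncs (uc s) (Iuh s) w (zc s) - Nes (uc s) (Iuh s) w (zc s)) = ⟪q s, w⟫)
    (zd : ℕ → H)
    (hzd0 : ∀ w : H,
      -⟪(t 1 - t 0)⁻¹ • (zd 1 - zd 0), w⟫ - Nes (ud 0) (uh 0) w (zd 1) = ⟪qd 0, w⟫)
    (hzdk : ∀ k, 1 ≤ k → k < N → ∀ w : H,
      -⟪(t k - t (k - 1))⁻¹ • (zd (k + 1) - zd k), w⟫ + B (zd k) w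
          + Ncs (ud k) (uh k) w (zd k)
          - ((t (k + 1) - t k) / (t k - t (k - 1))) * Nes (ud k) (uh k) w (zd (k + 1))
        = ⟪qd k, w⟫)
    (hzdN : ∀ w : H,
      ⟪zd N, w⟫ + (t N - t (N - 1)) * B (zd N) w
          + (t N - t (N - 1)) * Ncs (ud N) (uh N) w (zd N)
        = (t N - t (N - 1)) * ⟪qd N, w⟫ + ⟪qbar, w⟫) :
    (⟪qbar, uc T⟫ + ∫ s in (0:ℝ)..T, ⟪q s, uc s⟫)
        - (⟪qbar, Iut T⟫ + ∫ s in (0:ℝ)..T, ⟪q s, Iut s⟫)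
      = (⟪u0 - uh 0, zc 0 - zd 0⟫
          + ∑ k ∈ Finset.range N,
              ∫ s in (t k)..(t (k + 1)),
                ((⟪f s, zc s - zd (k + 1)⟫
                    - ⟪(t (k + 1) - t k)⁻¹ • (uh (k + 1) - uh k), zc s - zd (k + 1)⟫
                    - B (Iuh s) (zc s - zd (k + 1))
                    - (Nc (Iuh s) (zc s - zd (k + 1)) - Ne (Iuh s) (zc s - zd (k + 1))))
                  + (B (uh (k + 1)) (zd (k + 1)) + Nc (uh (k + 1)) (zd (k + 1))
                      - Ne (uh k) (zd (k + 1)) - B (Iuh s) (zd (k + 1))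
                      - (Nc (Iuh s) (zd (k + 1)) - Ne (Iuh s) (zd (k + 1))))))
        + ∑ k ∈ Finset.range N,
            ∫ s in (t k)..(t (k + 1)), ⟪f s - f (t (k + 1)), zd (k + 1)⟫ := by
  subst htT
  rw [← ht0] at hq hqd0 hf huc huc' huc0 hprimal hzc hzc' hdual
  simp only [← ht0] at hqdk
  rw [show (∫ s in (0 : ℝ)..(t N), ⟪q s, uc s⟫) = ∫ s in (t 0)..(t N), ⟪q s, uc s⟫ by rw [ht0],
    show (∫ s in (0 : ℝ)..(t N), ⟪q s, Iut s⟫) = ∫ s in (t 0)..(t N), ⟪q s, Iut s⟫ by rw [ht0],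
    show zc 0 = zc (t 0) by rw [ht0]]
  have hsub : ∀ k < N, Set.Icc (t k) (t (k + 1)) ⊆ Set.Icc (t 0) (t N) := fun k hk =>
    Set.Icc_subset_Icc (partition_mono ht (Nat.zero_le k) hk.le) (partition_mono ht hk le_rfl)
  have hB_addr : ∀ v a b : H, B v (a + b) = B v a + B v b := fun v a b => by
    rw [hB_symm, hB_add, hB_symm a, hB_symm b]
  have hB_sub : ∀ a b v : H, B (a - b) v = B a v - B b v := fun a b v =>
    additive_map_sub (g := fun x => B x v) (fun a b => hB_add a b v) a b
  have hu0 : ud 0 = u0 := ext_inner_right ℝ hud0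
  set e : ℕ → H := fun k => ud k - uh k with he
  set τ : ℕ → ℝ := fun k => t (k + 1) - t k with hτ
  have hτpos : ∀ k < N, 0 < τ k := fun k hk => sub_pos.2 (ht k hk)
  -- local residual of the reconstruction, tested with the continuous dual solution
  set ρ : ℕ → ℝ → ℝ := fun k s => ⟪f s, zc s⟫ - ⟪(τ k)⁻¹ • (uh (k + 1) - uh k), zc s⟫
    - B (Iuh s) (zc s) - (Nc (Iuh s) (zc s) - Ne (Iuh s) (zc s)) with hρ
  have hcont : ∀ k < N, IntervalIntegrable (ρ k) volume (t k) (t (k + 1)) ∧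
      ∫ s in (t k)..(t (k + 1)), ⟪q s, uc s - Iuh s⟫
        = (∫ s in (t k)..(t (k + 1)), ρ k s)
          + ⟪zc (t k), uc (t k) - uh k⟫ - ⟪zc (t (k + 1)), uc (t (k + 1)) - uh (k + 1)⟫ := by
    intro k hk
    have hpos := hτpos k hk
    set L : ℝ → H := fun s => ((t (k + 1) - s) / τ k) • uh k + ((s - t k) / τ k) • uh (k + 1)
      with hL
    have hLd : ∀ s, HasDerivAt L ((τ k)⁻¹ • (uh (k + 1) - uh k)) s := by
      intro s
      have h1 : HasDerivAt (fun s => (t (k + 1) - s) / τ k) (-1 / τ k) s :=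
        ((hasDerivAt_id s).const_sub _).div_const _
      have h2 : HasDerivAt (fun s => (s - t k) / τ k) (1 / τ k) s :=
        ((hasDerivAt_id s).sub_const _).div_const _
      refine ((h1.smul_const (uh k)).add (h2.smul_const (uh (k + 1)))).congr_deriv ?_
      rw [smul_sub, neg_div, neg_smul, one_div]
      abel
    have hIL : ∀ s ∈ Set.Icc (t k) (t (k + 1)), Iuh s = L s := fun s hs => hIuh k hk s hs
    have hLl : L (t k) = uh k := by
      simp only [hL, sub_self, zero_div, zero_smul, add_zero]
      rw [div_self hpos.ne', one_smul]
    have hLr : L (t (k + 1)) = uh (k + 1) := by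
      simp only [hL, sub_self, zero_div, zero_smul, zero_add]
      rw [div_self hpos.ne', one_smul]
    have main := integral_inner_eq_of_dual_identity (q := q) (ρ := ρ k) (e := fun s => uc s - L s)
      (ht k hk).le
      (fun s hs => (huc s (hsub k hk hs)).sub (hLd s)) (fun s hs => hzc s (hsub k hk hs))
      ((huc'.mono (hsub k hk)).sub continuousOn_const) (hzc'.mono (hsub k hk))
      (hq.mono (hsub k hk)) (by
        intro s hs
        rw [← hIL s hs, ← hdual s (hsub k hk hs), hNcs_mvl, hNes_mvl, hB_symm,
          hB_sub, inner_sub_right (zc s),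
          real_inner_comm _ (zc s), real_inner_comm _ (zc s)]
        have := hprimal s (hsub k hk hs) (zc s)
        simp only [hρ]
        linarith)
    simp only [hLl, hLr] at main
    refine ⟨main.1, ?_⟩
    rw [← main.2]
    refine intervalIntegral.integral_congr fun s hs => ?_
    rw [Set.uIcc_of_le (ht k hk).le] at hs
    simp only [hIL s hs]
  have hintq : ∀ (w : ℝ → H), (∀ k < N, ContinuousOn w (Set.Icc (t k) (t (k + 1)))) →
      ∀ k < N, IntervalIntegrable (fun s => ⟪q s, w s⟫) volume (t k) (t (k + 1)) :=
    fun w hw k hk =>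
      ((hq.mono (hsub k hk)).inner (hw k hk)).intervalIntegrable_of_Icc (ht k hk).le
  have hcu : ∀ k < N, ContinuousOn uc (Set.Icc (t k) (t (k + 1))) := fun k hk s hs =>
    (huc s (hsub k hk hs)).continuousAt.continuousWithinAt
  have hcIut : ∀ k < N, ContinuousOn Iut (Set.Icc (t k) (t (k + 1))) := fun k hk =>
    ContinuousOn.congr (by fun_prop) (hIut k hk)
  have hcIuh : ∀ k < N, ContinuousOn Iuh (Set.Icc (t k) (t (k + 1))) := fun k hk =>
    ContinuousOn.congr (by fun_prop) (hIuh k hk)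
  have hIutT : Iut (t N) = ud N := by
    obtain ⟨M, rfl⟩ : ∃ M, N = M + 1 := ⟨N - 1, by omega⟩
    rw [hIut M (by omega) _ ⟨(ht M (by omega)).le, le_rfl⟩, sub_self, zero_div, zero_smul,
      zero_add, div_self (sub_pos.2 (ht M (by omega))).ne', one_smul]
  -- pairing of the data with the nodal errors
  have hnodal := sum_integral_inner_piecewise_linear hN ht hq hhat hqd0 hqdk e
  -- splitting of the quantity of interest over the partition
  have hsplit : (∫ s in (t 0)..(t N), ⟪q s, uc s⟫) - ∫ s in (t 0)..(t N), ⟪q s, Iut s⟫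
      = ∑ k ∈ Finset.range N, (∫ s in (t k)..(t (k + 1)), ⟪q s, uc s - Iuh s⟫)
        - ∑ k ∈ Finset.range N, ∫ s in (t k)..(t (k + 1)),
          ⟪q s, ((t (k + 1) - s) / (t (k + 1) - t k)) • e k
            + ((s - t k) / (t (k + 1) - t k)) • e (k + 1)⟫ := by
    rw [← intervalIntegral.sum_integral_adjacent_intervals (hintq uc hcu),
      ← intervalIntegral.sum_integral_adjacent_intervals (hintq Iut hcIut),
      ← Finset.sum_sub_distrib, ← Finset.sum_sub_distrib]
    refine Finset.sum_congr rfl fun k hk => ?_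
    have hk := Finset.mem_range.1 hk
    rw [← intervalIntegral.integral_sub (hintq uc hcu k hk) (hintq Iut hcIut k hk),
      ← intervalIntegral.integral_sub
        (hintq (fun s => uc s - Iuh s) (fun k hk => (hcu k hk).sub (hcIuh k hk)) k hk)
        (((hq.mono (hsub k hk)).inner (by fun_prop)).intervalIntegrable_of_Icc (ht k hk).le)]
    refine intervalIntegral.integral_congr fun s hs => ?_
    rw [Set.uIcc_of_le (ht k hk).le] at hs
    simp only [← inner_sub_right, hIut k hk s hs, hIuh k hk s hs, he]
    congr 1
    module
  have htel : ∑ k ∈ Finset.range N, (∫ s in (t k)..(t (k + 1)), ⟪q s, uc s - Iuh s⟫)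
      = ∑ k ∈ Finset.range N, (∫ s in (t k)..(t (k + 1)), ρ k s)
        + ⟪zc (t 0), uc (t 0) - uh 0⟫ - ⟪zc (t N), uc (t N) - uh N⟫ := by
    rw [add_sub_assoc, ← Finset.sum_range_sub' (fun k => ⟪zc (t k), uc (t k) - uh k⟫) N,
      ← Finset.sum_add_distrib]
    refine Finset.sum_congr rfl fun k hk => ?_
    rw [(hcont k (Finset.mem_range.1 hk)).2]
    ring
  -- discrete residual, tested with the discrete dual solution
  set g : ℕ → ℝ := fun k => ⟪(τ k)⁻¹ • (uh (k + 1) - uh k), zd (k + 1)⟫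
    + B (uh (k + 1)) (zd (k + 1)) + Nc (uh (k + 1)) (zd (k + 1)) - Ne (uh k) (zd (k + 1))
    - ⟪f (t (k + 1)), zd (k + 1)⟫ with hg
  have hR : ∀ k < N, (∫ s in (t k)..(t (k + 1)),
      ((⟪f s, zc s - zd (k + 1)⟫
          - ⟪(t (k + 1) - t k)⁻¹ • (uh (k + 1) - uh k), zc s - zd (k + 1)⟫
          - B (Iuh s) (zc s - zd (k + 1))
          - (Nc (Iuh s) (zc s - zd (k + 1)) - Ne (Iuh s) (zc s - zd (k + 1))))
        + (B (uh (k + 1)) (zd (k + 1)) + Nc (uh (k + 1)) (zd (k + 1))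
            - Ne (uh k) (zd (k + 1)) - B (Iuh s) (zd (k + 1))
            - (Nc (Iuh s) (zd (k + 1)) - Ne (Iuh s) (zd (k + 1))))))
      + ∫ s in (t k)..(t (k + 1)), ⟪f s - f (t (k + 1)), zd (k + 1)⟫
      = (∫ s in (t k)..(t (k + 1)), ρ k s) + τ k * g k := by
    intro k hk
    have hO : IntervalIntegrable (fun s => ⟪f s - f (t (k + 1)), zd (k + 1)⟫)
        volume (t k) (t (k + 1)) :=
      (((hf.mono (hsub k hk)).sub continuousOn_const).inner
        continuousOn_const).intervalIntegrable_of_Icc (ht k hk).le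
    have hρi := (hcont k hk).1
    have hc : IntervalIntegrable (fun _ : ℝ => g k) volume (t k) (t (k + 1)) :=
      intervalIntegrable_const
    have hconst : τ k * g k = ∫ _ in (t k)..(t (k + 1)), g k := by
      rw [intervalIntegral.integral_const, smul_eq_mul]
    rw [hconst, ← intervalIntegral.integral_add hρi hc, ← eq_sub_iff_add_eq,
      ← intervalIntegral.integral_sub (hρi.add hc) hO]
    refine intervalIntegral.integral_congr fun s _ => ?_
    simp only [hρ, hg, inner_sub_right, inner_sub_left (f s), additive_map_sub (hB_addr (Iuh s)),
      additive_map_sub (hNc_add (Iuh s)), additive_map_sub (hNe_add (Iuh s))]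
    simp only [hτ]
    ring
  have hpair : ⟪qbar, e N⟫ + ((t 1 - t 0) * ⟪qd 0, e 0⟫
        + ∑ k ∈ Finset.range N, τ k * ⟪qd (k + 1), e (k + 1)⟫)
      = ⟪zd 0, e 0⟫ - ∑ k ∈ Finset.range N, τ k * g k := by
    have hp0 := hτpos 0 (by omega)
    set P : ℕ → ℝ := fun k => τ k * (B (zd (k + 1)) (e (k + 1))
      + (Nc (ud (k + 1)) (zd (k + 1)) - Nc (uh (k + 1)) (zd (k + 1)))) with hP
    set R : ℕ → ℝ := fun k => τ k * (Ne (ud k) (zd (k + 1)) - Ne (uh k) (zd (k + 1))) with hR'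
    have d0 : (t 1 - t 0) * ⟪qd 0, e 0⟫ = -⟪zd 1 - zd 0, e 0⟫ - R 0 := by
      rw [← hzd0, hNes_mvl, real_inner_smul_left]
      simp only [hR', hτ, zero_add] at hp0 ⊢
      field_simp
    have dk : ∀ k, k + 1 < N → τ k * ⟪qd (k + 1), e (k + 1)⟫
        = -⟪zd (k + 1 + 1) - zd (k + 1), e (k + 1)⟫ + P k - R (k + 1) := by
      intro k hk
      have hp := hτpos k (by omega)
      rw [← hzdk (k + 1) (by omega) hk, hNes_mvl, hNcs_mvl, real_inner_smul_left]
      simp only [hP, hR', hτ, Nat.add_sub_cancel] at hp ⊢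
      field_simp
      ring
    have hbal : ∀ k < N, ⟪zd (k + 1), e (k + 1) - e k⟫ + P k - R k = -(τ k * g k) := by
      intro k hk
      have hp := hτpos k hk
      have hu := hud k hk (zd (k + 1))
      simp only [hP, hR', hg]
      rw [hB_symm, hB_sub, ← hu,
        real_inner_smul_left, real_inner_smul_left,
        real_inner_comm _ (zd (k + 1))]
      have hee : e (k + 1) - e k = (ud (k + 1) - ud k) - (uh (k + 1) - uh k) := by
        simp only [he]
        abel
      rw [hee, inner_sub_left]
      simp only [hτ] at hp ⊢
      field_simp
      ring
    obtain ⟨M, rfl⟩ : ∃ M, N = M + 1 := ⟨N - 1, by omega⟩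
    have dN : ⟪qbar, e (M + 1)⟫ + τ M * ⟪qd (M + 1), e (M + 1)⟫
        = ⟪zd (M + 1), e (M + 1)⟫ + P M := by
      have h := hzdN (e (M + 1))
      rw [hNcs_mvl, Nat.add_sub_cancel] at h
      simp only [hP, hτ]
      linarith
    have hsbp := inner_summation_by_parts zd e (M + 1)
    have hsum := Finset.sum_congr rfl fun k hk => hbal k (Finset.mem_range.1 hk)
    rw [Finset.sum_sub_distrib, Finset.sum_add_distrib, Finset.sum_neg_distrib,
      Finset.sum_range_succ P, Finset.sum_range_succ' R] at hsum
    have hmid := Finset.sum_congr rfl fun k hk =>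
      dk k (Nat.succ_lt_succ (Finset.mem_range.1 hk))
    rw [Finset.sum_sub_distrib, Finset.sum_add_distrib] at hmid
    rw [Finset.sum_range_succ' (fun k => -⟪zd (k + 1) - zd k, e k⟫)] at hsbp
    rw [Finset.sum_range_succ (fun k => τ k * ⟪qd (k + 1), e (k + 1)⟫), d0, hmid]
    simp only [zero_add] at hsbp
    linarith
  rw [add_assoc, ← Finset.sum_add_distrib,
    Finset.sum_congr rfl fun k hk => hR k (Finset.mem_range.1 hk), Finset.sum_add_distrib]
  rw [htel, hnodal] at hsplit
  have h0 : e 0 = u0 - uh 0 := by rw [← hu0]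
  have hT' : ⟪qbar, uc (t N)⟫ - ⟪qbar, ud N⟫ = ⟪qbar, uc (t N) - uh N⟫ - ⟪qbar, e N⟫ := by
    simp only [he, inner_sub_right]
    ring
  rw [h0] at hpair hsplit
  rw [hzcT, huc0] at hsplit
  rw [hIutT, inner_sub_right (u0 - uh 0), real_inner_comm (zc (t 0)), real_inner_comm (zd 0)]
  linarith
end

section
/- Let u₀, …, u_N be the time-discrete IMEX primal solution, u₀^h, …, u_N^h the fully discrete IMEX–Galerkin solution, and z₀, …, z_N the IMEX time-discrete dual solution with data q̄ and q_k given by the hat-function averages of q. Then the error between the reconstructed time-discrete and fully discrete solutions equals the spatial error representation: for any v_k^h ∈ S_k (k = 0, …, N), Q(I u_τ) − Q(I u_τh) = (u⁰ − u₀^h, z₀ − v₀^h) + Σ_{k=1}^N τ_k ⟨r_h^k, z_k − v_k^h⟩, where I u_τ and I u_τh are the piecewise-linear time reconstructions of u₀, …, u_N and u₀^h, …, u_N^h respectively. -/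
open MeasureTheory RealInnerProductSpace

/-- A grid that increases up to index `N` is monotone up to index `N`. -/
theorem grid_le_of_le {t : ℕ → ℝ} {N : ℕ} (ht : ∀ k < N, t k < t (k + 1)) {i j : ℕ}
    (hij : i ≤ j) (hj : j ≤ N) : t i ≤ t j := by
  induction j, hij using Nat.le_induction with
  | base => exact le_rfl
  | succ n _ ih => exact (ih (by omega)).trans (ht n (by omega)).le

/-- On the grid cell `[t j, t (j + 1)]` only the hat functions of the two endpoints survive. -/
theorem hat_eq_on_cell {t : ℕ → ℝ} {N : ℕ} (ht : ∀ k < N, t k < t (k + 1)) {hatN : ℕ → ℝ → ℝ}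
    (hhat : ∀ k ≤ N, ∀ s : ℝ,
      hatN k s =
        if k < N ∧ s ∈ Set.Icc (t k) (t (k + 1)) then (t (k + 1) - s) / (t (k + 1) - t k)
        else if 1 ≤ k ∧ s ∈ Set.Icc (t (k - 1)) (t k) then (s - t (k - 1)) / (t k - t (k - 1))
        else 0)
    {j k : ℕ} (hj : j < N) (hk : k ≤ N) {s : ℝ} (hs : s ∈ Set.Icc (t j) (t (j + 1))) :
    hatN k s =
      if j = k then (t (j + 1) - s) / (t (j + 1) - t j)
      else if j + 1 = k then (s - t j) / (t (j + 1) - t j)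
      else 0 := by
  obtain ⟨hs1, hs2⟩ := hs
  rw [hhat k hk s]
  rcases lt_trichotomy j k with h | rfl | h
  · rw [if_neg h.ne]
    obtain rfl | h' : j + 1 = k ∨ j + 1 < k := by omega
    · rw [if_pos rfl]
      have hpos := ht j hj
      split_ifs with h1 h2
      · have e : s = t (j + 1) := le_antisymm hs2 h1.2.1
        have hpos' := ht (j + 1) h1.1
        rw [e, div_self (by linarith), div_self (by linarith)]
      · simp
      · exact absurd ⟨by omega, by simpa using hs1, hs2⟩ h2
    · rw [if_neg h'.ne]
      have hle : t (j + 1) ≤ t (k - 1) := grid_le_of_le ht (by omega) (by omega)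
      have hlt : t (k - 1) < t k := by
        have := ht (k - 1) (by omega)
        rwa [Nat.sub_add_cancel (by omega)] at this
      rw [if_neg fun h1 => by linarith [h1.2.1]]
      split_ifs with h2
      · rw [show s = t (k - 1) by linarith [h2.2.1], sub_self, zero_div]
      · rfl
  · rw [if_pos rfl, if_pos ⟨hj, hs1, hs2⟩]
  · rw [if_neg h.ne', if_neg (show j + 1 ≠ k by omega)]
    have hle : t (k + 1) ≤ t j := grid_le_of_le ht (by omega) (by omega)
    have hlt : t k < t (k + 1) := ht k (by omega)
    split_ifs with h1 h2
    · rw [show s = t (k + 1) by linarith [h1.2.2], sub_self, zero_div]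
    · linarith [h2.2.2]
    · rfl

/-- A function that agrees with a continuous one on each grid cell is integrable over the grid, and
its integral is the sum of the integrals over the cells. -/
theorem integral_eq_sum_cells {E : Type*} [NormedAddCommGroup E] [NormedSpace ℝ E]
    {t : ℕ → ℝ} {N : ℕ} (ht : ∀ k < N, t k < t (k + 1)) {f : ℝ → E} {g : ℕ → ℝ → E}
    (hg : ∀ j < N, ContinuousOn (g j) (Set.Icc (t j) (t (j + 1))))
    (hfg : ∀ j < N, ∀ s ∈ Set.Icc (t j) (t (j + 1)), f s = g j s) :
    IntervalIntegrable f volume (t 0) (t N) ∧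
    ∫ s in (t 0)..(t N), f s = ∑ j ∈ Finset.range N, ∫ s in (t j)..(t (j + 1)), g j s := by
  have hint : ∀ j < N, IntervalIntegrable f volume (t j) (t (j + 1)) := fun j hj => by
    apply ContinuousOn.intervalIntegrable_of_Icc (ht j hj).le
    exact (hg j hj).congr (hfg j hj)
  refine ⟨IntervalIntegrable.trans_iterate hint, ?_⟩
  rw [← intervalIntegral.sum_integral_adjacent_intervals hint]
  refine Finset.sum_congr rfl fun j hj => intervalIntegral.integral_congr fun s hs => ?_
  have hj' := Finset.mem_range.1 hj
  rw [Set.uIcc_of_le (ht j hj').le] at hs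
  exact hfg j hj' s hs

/-- Pairing `q` with a piecewise-linear reconstruction is the same as pairing the hat-function
moments of `q` with the nodal values. -/
theorem integral_inner_reconstruction
    {H : Type*} [NormedAddCommGroup H] [InnerProductSpace ℝ H] [CompleteSpace H]
    {t : ℕ → ℝ} {N : ℕ} (ht : ∀ k < N, t k < t (k + 1)) {hatN : ℕ → ℝ → ℝ}
    (hhat : ∀ k ≤ N, ∀ s : ℝ,
      hatN k s =
        if k < N ∧ s ∈ Set.Icc (t k) (t (k + 1)) then (t (k + 1) - s) / (t (k + 1) - t k)
        else if 1 ≤ k ∧ s ∈ Set.Icc (t (k - 1)) (t k) then (s - t (k - 1)) / (t k - t (k - 1))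
        else 0)
    {q : ℝ → H} (hq : ContinuousOn q (Set.Icc (t 0) (t N))) {w : ℕ → H} {Iw : ℝ → H}
    (hIw : ∀ k < N, ∀ s ∈ Set.Icc (t k) (t (k + 1)),
      Iw s = ((t (k + 1) - s) / (t (k + 1) - t k)) • w k
        + ((s - t k) / (t (k + 1) - t k)) • w (k + 1)) :
    ∫ s in (t 0)..(t N), ⟪q s, Iw s⟫
      = ∑ k ∈ Finset.range (N + 1), ⟪∫ s in (t 0)..(t N), hatN k s • q s, w k⟫ := by
  have hqc : ∀ j < N, ContinuousOn q (Set.Icc (t j) (t (j + 1))) := fun j hj =>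
    hq.mono (Set.Icc_subset_Icc (grid_le_of_le ht (Nat.zero_le j) hj.le)
      (grid_le_of_le ht hj le_rfl))
  have hmoment : ∀ k ∈ Finset.range (N + 1),
      IntervalIntegrable (fun s => hatN k s • q s) volume (t 0) (t N) := fun k hk => by
    refine (integral_eq_sum_cells ht (g := fun j s => (if j = k then
      (t (j + 1) - s) / (t (j + 1) - t j) else if j + 1 = k then (s - t j) / (t (j + 1) - t j)
      else 0) • q s) (fun j hj => ?_) fun j hj s hs => ?_).1
    · refine ContinuousOn.smul ?_ (hqc j hj)
      split_ifs <;> fun_prop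
    · rw [hat_eq_on_cell ht hhat hj (Finset.mem_range_succ_iff.1 hk) hs]
  have hswap : ∀ k ∈ Finset.range (N + 1), ⟪∫ s in (t 0)..(t N), hatN k s • q s, w k⟫
      = ∫ s in (t 0)..(t N), ⟪w k, hatN k s • q s⟫ := fun k hk => by
    rw [real_inner_comm]
    exact ((innerSL ℝ (w k)).intervalIntegral_comp_comm (hmoment k hk)).symm
  rw [Finset.sum_congr rfl hswap, ← intervalIntegral.integral_finsetSum fun k hk =>
    (⟨(innerSL ℝ (w k)).integrable_comp (hmoment k hk).1,
      (innerSL ℝ (w k)).integrable_comp (hmoment k hk).2⟩ :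
      IntervalIntegrable (fun s => ⟪w k, hatN k s • q s⟫) volume (t 0) (t N))]
  have hg : ∀ j < N, ContinuousOn (fun s => ⟪q s, ((t (j + 1) - s) / (t (j + 1) - t j)) • w j
      + ((s - t j) / (t (j + 1) - t j)) • w (j + 1)⟫) (Set.Icc (t j) (t (j + 1))) := fun j hj =>
    (hqc j hj).inner (Continuous.continuousOn (by fun_prop))
  refine (integral_eq_sum_cells ht hg fun j hj s hs => ?_).2.trans
    (integral_eq_sum_cells ht hg fun j hj s hs => ?_).2.symm
  · rw [hIw j hj s hs]
  · have hterm : ∀ k ∈ Finset.range (N + 1), ⟪w k, hatN k s • q s⟫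
        = (if j = k then (t (j + 1) - s) / (t (j + 1) - t j) * ⟪q s, w k⟫ else 0)
          + (if j + 1 = k then (s - t j) / (t (j + 1) - t j) * ⟪q s, w k⟫ else 0) := fun k hk => by
      rw [hat_eq_on_cell ht hhat hj (Finset.mem_range_succ_iff.1 hk) hs, real_inner_smul_right,
        real_inner_comm]
      split_ifs with h1 h2
      · omega
      all_goals simp
    rw [Finset.sum_congr rfl hterm, Finset.sum_add_distrib, Finset.sum_ite_eq, Finset.sum_ite_eq,
      if_pos (Finset.mem_range.2 (by omega)), if_pos (Finset.mem_range.2 (by omega)),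
      inner_add_right, real_inner_smul_right, real_inner_smul_right]

/-- Spatial error representation: the error between the reconstructed time-discrete IMEX
solution `I u_τ` and the reconstructed fully discrete solution `I u_τh` in the quantity of
interest equals the dual-weighted spatial residual,
`Q(I u_τ) - Q(I u_τh) = (u⁰ - u₀ʰ, z₀ - v₀ʰ) + Σ_{k=1}^N τ_k ⟨r_h^k, z_k - v_kʰ⟩`. -/
theorem spatial_error_representation
    {H : Type*} [NormedAddCommGroup H] [InnerProductSpace ℝ H] [CompleteSpace H]
    (B Nc Ne : H → H → ℝ) (Ncs Nes : H → H → H → H → ℝ)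
    (hB_cont : Continuous fun p : H × H => B p.1 p.2)
    (hB_symm : ∀ a b : H, B a b = B b a)
    (hB_add : ∀ a b v : H, B (a + b) v = B a v + B b v)
    (hB_smul : ∀ (c : ℝ) (a v : H), B (c • a) v = c * B a v)
    (hNc_cont : Continuous fun p : H × H => Nc p.1 p.2)
    (hNe_cont : Continuous fun p : H × H => Ne p.1 p.2)
    (hNc_add : ∀ u v w : H, Nc u (v + w) = Nc u v + Nc u w)
    (hNc_smul : ∀ (u : H) (c : ℝ) (v : H), Nc u (c • v) = c * Nc u v)
    (hNe_add : ∀ u v w : H, Ne u (v + w) = Ne u v + Ne u w)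
    (hNe_smul : ∀ (u : H) (c : ℝ) (v : H), Ne u (c • v) = c * Ne u v)
    (hNcs_addw : ∀ a b w₁ w₂ v : H, Ncs a b (w₁ + w₂) v = Ncs a b w₁ v + Ncs a b w₂ v)
    (hNcs_smulw : ∀ (a b : H) (c : ℝ) (w v : H), Ncs a b (c • w) v = c * Ncs a b w v)
    (hNcs_addv : ∀ a b w v₁ v₂ : H, Ncs a b w (v₁ + v₂) = Ncs a b w v₁ + Ncs a b w v₂)
    (hNcs_smulv : ∀ (a b : H) (c : ℝ) (w v : H), Ncs a b w (c • v) = c * Ncs a b w v)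
    (hNes_addw : ∀ a b w₁ w₂ v : H, Nes a b (w₁ + w₂) v = Nes a b w₁ v + Nes a b w₂ v)
    (hNes_smulw : ∀ (a b : H) (c : ℝ) (w v : H), Nes a b (c • w) v = c * Nes a b w v)
    (hNes_addv : ∀ a b w v₁ v₂ : H, Nes a b w (v₁ + v₂) = Nes a b w v₁ + Nes a b w v₂)
    (hNes_smulv : ∀ (a b : H) (c : ℝ) (w v : H), Nes a b w (c • v) = c * Nes a b w v)
    (hNcs_mvl : ∀ a b v : H, Ncs a b (a - b) v = Nc a v - Nc b v)
    (hNes_mvl : ∀ a b v : H, Nes a b (a - b) v = Ne a v - Ne b v)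
    (T : ℝ) (hT : 0 < T)
    (N : ℕ) (hN : 1 ≤ N)
    (t : ℕ → ℝ) (ht0 : t 0 = 0) (htT : t N = T)
    (ht : ∀ k < N, t k < t (k + 1))
    (qbar : H) (q : ℝ → H) (hq : ContinuousOn q (Set.Icc 0 T))
    (hatN : ℕ → ℝ → ℝ)
    (hhat : ∀ k ≤ N, ∀ s : ℝ,
      hatN k s =
        if k < N ∧ s ∈ Set.Icc (t k) (t (k + 1)) then (t (k + 1) - s) / (t (k + 1) - t k)
        else if 1 ≤ k ∧ s ∈ Set.Icc (t (k - 1)) (t k) then (s - t (k - 1)) / (t k - t (k - 1))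
        else 0)
    (qd : ℕ → H)
    (hqd0 : qd 0 = (t 1 - t 0)⁻¹ • ∫ s in (0:ℝ)..T, hatN 0 s • q s)
    (hqdk : ∀ k, 1 ≤ k → k ≤ N →
      qd k = (t k - t (k - 1))⁻¹ • ∫ s in (0:ℝ)..T, hatN k s • q s)
    (S : ℕ → Submodule ℝ H) (hS : ∀ k ≤ N, IsClosed (S k : Set H))
    (u0 : H) (fd : ℕ → H)
    (ud : ℕ → H)
    (hud0 : ∀ v : H, ⟪ud 0, v⟫ = ⟪u0, v⟫)
    (hud : ∀ k < N, ∀ v : H,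
      ⟪(t (k + 1) - t k)⁻¹ • (ud (k + 1) - ud k), v⟫ + B (ud (k + 1)) v
        + Nc (ud (k + 1)) v - Ne (ud k) v = ⟪fd (k + 1), v⟫)
    (uh : ℕ → H) (huh_mem : ∀ k ≤ N, uh k ∈ S k)
    (huh0 : ∀ v ∈ S 0, ⟪uh 0, v⟫ = ⟪u0, v⟫)
    (huh : ∀ k < N, ∀ v ∈ S (k + 1),
      ⟪(t (k + 1) - t k)⁻¹ • (uh (k + 1) - uh k), v⟫ + B (uh (k + 1)) v
        + Nc (uh (k + 1)) v - Ne (uh k) v = ⟪fd (k + 1), v⟫)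
    (zd : ℕ → H)
    (hzd0 : ∀ w : H,
      -⟪(t 1 - t 0)⁻¹ • (zd 1 - zd 0), w⟫ - Nes (ud 0) (uh 0) w (zd 1) = ⟪qd 0, w⟫)
    (hzdk : ∀ k, 1 ≤ k → k < N → ∀ w : H,
      -⟪(t k - t (k - 1))⁻¹ • (zd (k + 1) - zd k), w⟫ + B (zd k) w
          + Ncs (ud k) (uh k) w (zd k)
          - ((t (k + 1) - t k) / (t k - t (k - 1))) * Nes (ud k) (uh k) w (zd (k + 1))
        = ⟪qd k, w⟫)
    (hzdN : ∀ w : H,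
      ⟪zd N, w⟫ + (t N - t (N - 1)) * B (zd N) w
          + (t N - t (N - 1)) * Ncs (ud N) (uh N) w (zd N)
        = (t N - t (N - 1)) * ⟪qd N, w⟫ + ⟪qbar, w⟫)
    (Iut Iuh : ℝ → H)
    (hIut : ∀ k < N, ∀ s ∈ Set.Icc (t k) (t (k + 1)),
      Iut s = ((t (k + 1) - s) / (t (k + 1) - t k)) • ud k
        + ((s - t k) / (t (k + 1) - t k)) • ud (k + 1))
    (hIuh : ∀ k < N, ∀ s ∈ Set.Icc (t k) (t (k + 1)),
      Iuh s = ((t (k + 1) - s) / (t (k + 1) - t k)) • uh k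
        + ((s - t k) / (t (k + 1) - t k)) • uh (k + 1)) :
    ∀ vh : ℕ → H, (∀ k ≤ N, vh k ∈ S k) →
      (⟪qbar, Iut T⟫ + ∫ s in (0:ℝ)..T, ⟪q s, Iut s⟫)
          - (⟪qbar, Iuh T⟫ + ∫ s in (0:ℝ)..T, ⟪q s, Iuh s⟫)
        = ⟪u0 - uh 0, zd 0 - vh 0⟫
          + ∑ k ∈ Finset.Icc 1 N,
              (t k - t (k - 1)) *
                (⟪fd k, zd k - vh k⟫
                  - ⟪(t k - t (k - 1))⁻¹ • (uh k - uh (k - 1)), zd k - vh k⟫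
                  - B (uh k) (zd k - vh k) - Nc (uh k) (zd k - vh k)
                  + Ne (uh (k - 1)) (zd k - vh k)) := by
  intro vh hvh
  obtain ⟨M, rfl⟩ : ∃ M, N = M + 1 := ⟨N - 1, by omega⟩
  have hqt : ContinuousOn q (Set.Icc (t 0) (t (M + 1))) := by rwa [ht0, htT]
  have hIut' := integral_inner_reconstruction ht hhat hqt hIut
  have hIuh' := integral_inner_reconstruction ht hhat hqt hIuh
  have hτ : ∀ k < M + 1, t (k + 1) - t k ≠ 0 := fun k hk => (sub_pos.2 (ht k hk)).ne'
  have hend : ∀ w : ℕ → H, ∀ Iw : ℝ → H, (∀ k < M + 1, ∀ s ∈ Set.Icc (t k) (t (k + 1)),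
      Iw s = ((t (k + 1) - s) / (t (k + 1) - t k)) • w k
        + ((s - t k) / (t (k + 1) - t k)) • w (k + 1)) → Iw T = w (M + 1) := fun w Iw h => by
    rw [← htT, h M M.lt_succ_self _ (Set.right_mem_Icc.2 (ht M M.lt_succ_self).le), sub_self,
      zero_div, zero_smul, zero_add, div_self (hτ M M.lt_succ_self), one_smul]
  rw [hend _ _ hIut, hend _ _ hIuh, ← ht0, ← htT, hIut', hIuh', ht0, htT]
  have hm0 : ∫ s in (0 : ℝ)..T, hatN 0 s • q s = (t 1 - t 0) • qd 0 := by
    rw [hqd0, smul_inv_smul₀ (hτ 0 M.succ_pos)]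
  have hm : ∀ k < M + 1, ∫ s in (0 : ℝ)..T, hatN (k + 1) s • q s
      = (t (k + 1) - t k) • qd (k + 1) := fun k hk => by
    rw [hqdk (k + 1) (by omega) (by omega), Nat.add_sub_cancel, smul_inv_smul₀ (hτ k hk)]
  have hBsub : ∀ a b v, B (a - b) v = B a v - B b v := fun a b v => by
    rw [sub_eq_add_neg, ← neg_one_smul ℝ b, hB_add, hB_smul]; ring
  have hNcsub : ∀ u v w, Nc u (v - w) = Nc u v - Nc u w := fun u v w => by
    rw [sub_eq_add_neg, ← neg_one_smul ℝ w, hNc_add, hNc_smul]; ring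
  have hNesub : ∀ u v w, Ne u (v - w) = Ne u v - Ne u w := fun u v w => by
    rw [sub_eq_add_neg, ← neg_one_smul ℝ w, hNe_add, hNe_smul]; ring
  have hresidual : ∀ k < M + 1,
      (t (k + 1) - t k) *
        (⟪fd (k + 1), zd (k + 1) - vh (k + 1)⟫
          - ⟪(t (k + 1) - t k)⁻¹ • (uh (k + 1) - uh k), zd (k + 1) - vh (k + 1)⟫
          - B (uh (k + 1)) (zd (k + 1) - vh (k + 1)) - Nc (uh (k + 1)) (zd (k + 1) - vh (k + 1))
          + Ne (uh k) (zd (k + 1) - vh (k + 1)))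
      = ⟪ud (k + 1) - uh (k + 1), zd (k + 1)⟫ - ⟪ud k - uh k, zd (k + 1)⟫
        + (t (k + 1) - t k) * (B (zd (k + 1)) (ud (k + 1) - uh (k + 1))
          + (Nc (ud (k + 1)) (zd (k + 1)) - Nc (uh (k + 1)) (zd (k + 1)))
          - (Ne (ud k) (zd (k + 1)) - Ne (uh k) (zd (k + 1)))) := fun k hk => by
    have h1 := hud k hk (zd (k + 1))
    have h2 := huh k hk (vh (k + 1)) (hvh (k + 1) (by omega))
    have hBv : ∀ a v w, B a (v - w) = B a v - B a w := fun a v w => by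
      rw [hB_symm, hBsub, hB_symm v, hB_symm w]
    simp only [real_inner_smul_left, inner_sub_left, inner_sub_right, hBv, hNcsub, hNesub] at h1 h2 ⊢
    rw [← h1, ← h2, hB_symm (zd (k + 1)) (ud (k + 1)), hB_symm (zd (k + 1)) (uh (k + 1))]
    have := hτ k hk
    field_simp
    ring
  have hpartial : ∀ n < M + 1,
      ∑ k ∈ Finset.range (n + 1), ⟪∫ s in (0 : ℝ)..T, hatN k s • q s, ud k - uh k⟫
      = ⟪zd 0, ud 0 - uh 0⟫ + ∑ k ∈ Finset.Icc 1 n,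
              (t k - t (k - 1)) *
                (⟪fd k, zd k - vh k⟫
                  - ⟪(t k - t (k - 1))⁻¹ • (uh k - uh (k - 1)), zd k - vh k⟫
                  - B (uh k) (zd k - vh k) - Nc (uh k) (zd k - vh k)
                  + Ne (uh (k - 1)) (zd k - vh k))
        - ⟪ud n - uh n, zd (n + 1)⟫
        - (t (n + 1) - t n) * (Ne (ud n) (zd (n + 1)) - Ne (uh n) (zd (n + 1))) := fun n hn => by
    induction n with
    | zero =>
      have h := hzd0 (ud 0 - uh 0)
      rw [hNes_mvl, real_inner_smul_left, inner_sub_left] at h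
      rw [zero_add, Finset.sum_range_one, hm0, real_inner_smul_left, ← h,
        real_inner_comm (zd 1)]
      have := hτ 0 hn
      rw [zero_add] at this
      simp only [Finset.Icc_eq_empty_of_lt one_pos, Finset.sum_empty]
      field_simp
      ring
    | succ n ih =>
      have h := hzdk (n + 1) (by omega) hn (ud (n + 1) - uh (n + 1))
      have := hτ n (by omega)
      rw [hNes_mvl, hNcs_mvl, real_inner_smul_left, inner_sub_left, Nat.add_sub_cancel] at h
      rw [Finset.sum_range_succ, ih (by omega), hm n (by omega), real_inner_smul_left, ← h,
        Finset.sum_Icc_succ_top (by omega), Nat.add_sub_cancel, hresidual n (by omega),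
        real_inner_comm (zd (n + 1)) (ud (n + 1) - uh (n + 1)),
        real_inner_comm (zd (n + 1 + 1)) (ud (n + 1) - uh (n + 1))]
      field_simp
      ring
  have hlast := hzdN (ud (M + 1) - uh (M + 1))
  have hinit : ⟪u0 - uh 0, zd 0 - vh 0⟫ = ⟪zd 0, ud 0 - uh 0⟫ := by
    have h1 := hud0 (zd 0)
    have h2 := huh0 (vh 0) (hvh 0 (Nat.zero_le _))
    rw [real_inner_comm (ud 0 - uh 0)]
    simp only [inner_sub_left, inner_sub_right]
    linarith
  rw [hNcs_mvl, Nat.add_sub_cancel] at hlast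
  have hM := hpartial M M.lt_succ_self
  have hsplit : ∀ a b c d : ℝ, a + b - (c + d) = a - c + (b - d) := fun a b c d => by ring
  rw [hsplit, ← Finset.sum_sub_distrib, ← inner_sub_right]
  simp only [← inner_sub_right]
  rw [Finset.sum_range_succ, hM, hm M M.lt_succ_self, real_inner_smul_left, hinit,
    Finset.sum_Icc_succ_top (by omega), Nat.add_sub_cancel, hresidual M M.lt_succ_self,
    real_inner_comm (zd (M + 1)) (ud (M + 1) - uh (M + 1))]
  linarith
end
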